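/- Let p be a prime and let G be a finite p-solvable group. For any chief series 1 = N_0 < N_1 < ... < N_r = G of G, the number of indices i for which the chief factor N_{i+1}/N_i is a p-group is at most the number of nonprincipal Q_p-valued irreducible characters of G. -/

import Mathlib

open scoped Classical

noncomputable section

/-- `Qfield p` is the subfield of `ℂ` obtained by adjoining to `ℚ` all `p^a`-th
roots of unity for all positive integers `a` (any subfield of `ℂ` contains `ℚ`). -/
def Qfield (p : ℕ) : Subfield ℂ :=
  Subfield.closure {x : ℂ | ∃ a : ℕ, 0 < a ∧ x ^ p ^ a = 1}

/-- `χ : G → ℂ` is an irreducible (ordinary, complex) character of `G` if it is the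
character of some simple finite-dimensional complex representation of `G`. -/
def IsIrreducibleCharacter (G : Type) [Group G] (χ : G → ℂ) : Prop :=
  ∃ V : FDRep ℂ G, CategoryTheory.Simple V ∧ χ = fun g => V.character g

/-- A group `G` is `p`-solvable if it has a subnormal series in which every factor is
either a `p`-group or a group of order coprime to `p` (factors are expressed via the
cardinality of the corresponding coset spaces). -/
def IsPSolvable (p : ℕ) (G : Type) [Group G] : Prop :=
  ∃ (n : ℕ) (H : ℕ → Subgroup G),
    H 0 = ⊥ ∧ H n = ⊤ ∧
    (∀ i, i < n → H i ≤ H (i + 1)) ∧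
    (∀ i, i < n → ((H i).subgroupOf (H (i + 1))).Normal) ∧
    (∀ i, i < n →
      (∃ k : ℕ, Nat.card ((H (i + 1) : Subgroup G) ⧸ (H i).subgroupOf (H (i + 1))) = p ^ k) ∨
      Nat.Coprime (Nat.card ((H (i + 1) : Subgroup G) ⧸ (H i).subgroupOf (H (i + 1)))) p)

namespace QpChars

open MonoidAlgebra in
theorem span_range_of (K M : Type*) [Field K] [Monoid M] :
    Submodule.span K (Set.range (of K M)) = ⊤ := by
  refine eq_top_iff.2 fun x _ => ?_
  induction x using MonoidAlgebra.induction_on with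
  | of m => exact Submodule.subset_span ⟨m, rfl⟩
  | add x y hx hy => exact Submodule.add_mem _ (hx trivial) (hy trivial)
  | smul c x hx => exact Submodule.smul_mem _ _ (hx trivial)

/-- Two linear maps out of a space agree as soon as they agree on a spanning family. -/
theorem linearMap_eq_of_span {K V W ι : Type*} [Field K] [AddCommGroup V] [Module K V]
    [AddCommGroup W] [Module K W] {v : ι → V} (hv : Submodule.span K (Set.range v) = ⊤)
    {f g : V →ₗ[K] W} (h : ∀ i, f (v i) = g (v i)) (x : V) : f x = g x := by
  rw [LinearMap.ext_on_range hv h]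

/-- The kernel of an algebra map out of a semisimple group algebra is cut out by a central
idempotent. -/
theorem exists_central_idempotent {K : Type*} [Field K] [CharZero K] {M : Type*} [Group M]
    [Finite M] {B : Type*} [Ring B] [Algebra K B] (π : MonoidAlgebra K M →ₐ[K] B) :
    ∃ e : MonoidAlgebra K M, e * e = e ∧ (∀ x, e * x = x * e) ∧ π e = 1 ∧
      ∀ x, π x = 0 → e * x = 0 := by
  have := Fintype.ofFinite M
  set I : Submodule K (MonoidAlgebra K M) := LinearMap.ker π.toLinearMap with hI
  have hIm : ∀ x, x ∈ I ↔ π x = 0 := fun x => by simp [hI]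
  obtain ⟨P₀, hP₀⟩ := LinearMap.exists_leftInverse_of_injective I.subtype (by simp)
  set o := MonoidAlgebra.of K M
  have oo : ∀ g : M, o g * o g⁻¹ = 1 := fun g => by rw [← map_mul]; simp
  have oo' : ∀ g : M, o g⁻¹ * o g = 1 := fun g => by rw [← map_mul]; simp
  set P := fun x : MonoidAlgebra K M =>
    ∑ g : M, ∑ h : M, o g⁻¹ * (P₀ (o g * x * o h) : MonoidAlgebra K M) * o h⁻¹ with hP
  have hPI : ∀ x, π (P x) = 0 := fun x => by
    have : ∀ y, π (P₀ y : MonoidAlgebra K M) = 0 := fun y => (hIm _).1 (P₀ y).2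
    simp [hP, map_sum, this]
  have hPid : ∀ x, π x = 0 → P x = ((Fintype.card M : K) ^ 2) • x := fun x hx => by
    have : ∀ g h : M, o g⁻¹ * (P₀ (o g * x * o h) : MonoidAlgebra K M) * o h⁻¹ = x := by
      intro g h
      have h1 : o g * x * o h ∈ I := by rw [hIm]; simp [hx]
      have h2 : P₀ (o g * x * o h) = ⟨_, h1⟩ := LinearMap.congr_fun hP₀ ⟨_, h1⟩
      rw [h2]
      simp only [← mul_assoc, oo', one_mul]
      rw [mul_assoc, oo, mul_one]
    simp only [hP, this]
    simp only [Finset.sum_const, Finset.card_univ, ← Nat.cast_smul_eq_nsmul K, smul_smul, sq]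
  have hPl : ∀ k x, P (o k * x) = o k * P x := fun k x => by
    simp only [hP, Finset.mul_sum]
    rw [← Equiv.sum_comp (Equiv.mulRight k⁻¹)]
    refine Finset.sum_congr rfl fun g _ => Finset.sum_congr rfl fun h _ => ?_
    simp only [Equiv.coe_mulRight, mul_inv_rev, inv_inv, map_mul, mul_assoc]
    rw [← mul_assoc (o k⁻¹) (o k), oo', one_mul]
  have hPr : ∀ k x, P (x * o k) = P x * o k := fun k x => by
    simp only [hP, Finset.sum_mul]
    refine Finset.sum_congr rfl fun g _ => ?_
    rw [← Equiv.sum_comp (Equiv.mulLeft k⁻¹)]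
    refine Finset.sum_congr rfl fun h _ => ?_
    simp only [Equiv.coe_mulLeft, mul_inv_rev, inv_inv, map_mul, mul_assoc]
    rw [← mul_assoc (o k) (o k⁻¹), oo, one_mul]
  set PL : MonoidAlgebra K M →ₗ[K] MonoidAlgebra K M :=
    { toFun := P
      map_add' := fun x y => by simp [hP, mul_add, add_mul, Finset.sum_add_distrib]
      map_smul' := fun c x => by simp [hP, Finset.smul_sum] }
  have hc : ((Fintype.card M : K) ^ 2) ≠ 0 := by simp
  set u := ((Fintype.card M : K) ^ 2)⁻¹ • P 1 with hu
  have hux : ∀ x, u * x = ((Fintype.card M : K) ^ 2)⁻¹ • P x := fun x => by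
    refine linearMap_eq_of_span (span_range_of K M) (f := LinearMap.mulLeft K u)
      (g := ((Fintype.card M : K) ^ 2)⁻¹ • PL) (fun m => ?_) x
    have := hPr m 1
    rw [one_mul] at this
    simp only [LinearMap.mulLeft_apply, LinearMap.smul_apply, hu]
    exact (smul_mul_assoc _ _ _).trans (congrArg _ this.symm)
  have hxu : ∀ x, x * u = ((Fintype.card M : K) ^ 2)⁻¹ • P x := fun x => by
    refine linearMap_eq_of_span (span_range_of K M) (f := LinearMap.mulRight K u)
      (g := ((Fintype.card M : K) ^ 2)⁻¹ • PL) (fun m => ?_) x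
    have := hPl m 1
    rw [mul_one] at this
    simp only [LinearMap.mulRight_apply, LinearMap.smul_apply, hu]
    exact (mul_smul_comm _ _ _).trans (congrArg _ this.symm)
  have hk : ∀ x, π x = 0 → (1 - u) * x = 0 := fun x hx => by
    rw [sub_mul, one_mul, hux, hPid x hx, smul_smul, inv_mul_cancel₀ hc, one_smul, sub_self]
  have hπu : π u = 0 := by simp [hu, hPI]
  refine ⟨1 - u, ?_, fun x => ?_, by simp [hπu], hk⟩
  · rw [mul_sub, hk u hπu, mul_one, sub_zero]
  · rw [sub_mul, mul_sub, hux, hxu, one_mul, mul_one]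

theorem map_mul_map_inv {M B : Type*} [Group M] [Monoid B] (ρ : M →* B) (m : M) :
    ρ m * ρ m⁻¹ = 1 := by rw [← map_mul]; simp

theorem map_inv_mul_map {M B : Type*} [Group M] [Monoid B] (ρ : M →* B) (m : M) :
    ρ m⁻¹ * ρ m = 1 := by rw [← map_mul]; simp

section Average

variable {K : Type*} [Field K] {B : Type*} [Ring B] [Algebra K B] {M : Type*} [Group M]
  [Fintype M] (ρ : M →* B)

/-- Sum of the conjugates of `x` under a group acting by units. -/
def conjSum : B →ₗ[K] B where
  toFun x := ∑ m : M, ρ m * x * ρ m⁻¹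
  map_add' x y := by simp [mul_add, add_mul, Finset.sum_add_distrib]
  map_smul' c x := by simp [Finset.smul_sum]

theorem conjSum_apply (x : B) : conjSum (K := K) ρ x = ∑ m : M, ρ m * x * ρ m⁻¹ := rfl

theorem map_mul_conjSum (k : M) (x : B) :
    ρ k * conjSum (K := K) ρ x = conjSum (K := K) ρ x * ρ k := by
  simp only [conjSum_apply, Finset.mul_sum, Finset.sum_mul]
  rw [← Equiv.sum_comp (Equiv.mulLeft k) fun m => ρ m * x * ρ m⁻¹ * ρ k]
  refine Finset.sum_congr rfl fun m _ => ?_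
  simp only [Equiv.coe_mulLeft, mul_inv_rev, map_mul, mul_assoc, map_inv_mul_map, mul_one]

variable {ρ}

theorem conjSum_mem_center (hρ : Submodule.span K (Set.range ρ) = ⊤) (x : B) :
    conjSum (K := K) ρ x ∈ Subalgebra.center K B := by
  rw [Subalgebra.mem_center_iff]
  exact fun b => linearMap_eq_of_span hρ (f := LinearMap.mulRight K (conjSum (K := K) ρ x))
    (g := LinearMap.mulLeft K (conjSum (K := K) ρ x)) (fun k => map_mul_conjSum ρ k x) b

theorem conjSum_of_central {z : B} (hz : ∀ b, z * b = b * z) :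
    conjSum (K := K) ρ z = (Fintype.card M : K) • z := by
  simp [conjSum_apply, ← hz, mul_assoc, map_mul_map_inv, Nat.cast_smul_eq_nsmul]

end Average

section Functional

variable {K : Type*} [Field K] [CharZero K] {B : Type*} [Ring B] [Algebra K B] [Nontrivial B]
  [Algebra.IsCentral K B] {M : Type*} [Group M] [Fintype M] (ρ : M →* B)

/-- On a central algebra spanned by a finite group, averaging over conjugates is a functional. -/
theorem exists_average (hρ : Submodule.span K (Set.range ρ) = ⊤) :
    ∃ c : B →ₗ[K] K, ∀ x, conjSum (K := K) ρ x = ((Fintype.card M : K) * c x) • (1 : B) := by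
  obtain ⟨l, hl⟩ := LinearMap.exists_leftInverse_of_injective (Algebra.linearMap K B)
    (LinearMap.ker_eq_bot.2 (FaithfulSMul.algebraMap_injective K B))
  refine ⟨(Fintype.card M : K)⁻¹ • l ∘ₗ conjSum ρ, fun x => ?_⟩
  have hx := conjSum_mem_center (K := K) hρ x
  rw [Algebra.IsCentral.center_eq_bot, Algebra.mem_bot] at hx
  obtain ⟨k, hk⟩ := hx
  have h1 : l (conjSum (K := K) ρ x) = k := by rw [← hk]; exact LinearMap.congr_fun hl k
  have h2 : (Fintype.card M : K) ≠ 0 := by simp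
  simp only [LinearMap.smul_apply, LinearMap.comp_apply, smul_eq_mul, h1]
  rw [mul_inv_cancel_left₀ h2, ← hk, Algebra.algebraMap_eq_smul_one]

end Functional

section Trace

variable {K : Type*} [Field K] [CharZero K] {B : Type*} [Ring B] [Algebra K B] [Module.Finite K B]
  {M : Type*} [Group M] [Fintype M] {ρ : M →* B} {c : B →ₗ[K] K}
  (hc : ∀ x, conjSum (K := K) ρ x = ((Fintype.card M : K) * c x) • (1 : B))
include hc

theorem trace_mulLeft_mulRight (a b : B) :
    LinearMap.trace K B (LinearMap.mulLeft K a ∘ₗ LinearMap.mulRight K b) =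
      c a * LinearMap.trace K B (LinearMap.mulRight K b) := by
  have h2 : (Fintype.card M : K) ≠ 0 := by simp
  apply mul_left_cancel₀ h2
  have key : ∀ m : M, LinearMap.trace K B
      (LinearMap.mulLeft K (ρ m * a * ρ m⁻¹) ∘ₗ LinearMap.mulRight K b) =
      LinearMap.trace K B (LinearMap.mulLeft K a ∘ₗ LinearMap.mulRight K b) := fun m => by
    have h3 : LinearMap.mulLeft K (ρ m * a * ρ m⁻¹) ∘ₗ LinearMap.mulRight K b =
        LinearMap.mulLeft K (ρ m) ∘ₗ
          ((LinearMap.mulLeft K a ∘ₗ LinearMap.mulRight K b) ∘ₗ LinearMap.mulLeft K (ρ m⁻¹)) := by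
      ext x; simp [mul_assoc]
    rw [h3, LinearMap.trace_comp_comm', LinearMap.comp_assoc, ← LinearMap.mulLeft_mul,
      map_inv_mul_map, LinearMap.mulLeft_one, LinearMap.comp_id]
  have h4 : ∑ m : M, LinearMap.mulLeft K (ρ m * a * ρ m⁻¹) ∘ₗ LinearMap.mulRight K b =
      ((Fintype.card M : K) * c a) • LinearMap.mulRight K b := by
    ext x
    simp only [LinearMap.sum_apply, LinearMap.comp_apply, LinearMap.mulLeft_apply,
      ← Finset.sum_mul, ← conjSum_apply (K := K), hc, LinearMap.smul_apply, smul_mul_assoc,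
      one_mul]
  have h5 := congrArg (LinearMap.trace K B) h4
  rw [map_sum, Finset.sum_congr rfl fun m _ => key m, map_smul] at h5
  simpa [mul_assoc] using h5

theorem trace_mulRight (b : B) :
    LinearMap.trace K B (LinearMap.mulRight K b) = Module.finrank K B * c b := by
  have h2 : (Fintype.card M : K) ≠ 0 := by simp
  apply mul_left_cancel₀ h2
  have key : ∀ m : M, LinearMap.trace K B (LinearMap.mulRight K (ρ m * b * ρ m⁻¹)) =
      LinearMap.trace K B (LinearMap.mulRight K b) := fun m => by
    have h3 : LinearMap.mulRight K (ρ m * b * ρ m⁻¹) = LinearMap.mulRight K (ρ m⁻¹) ∘ₗ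
          (LinearMap.mulRight K b ∘ₗ LinearMap.mulRight K (ρ m)) := by
      ext x; simp [mul_assoc]
    rw [h3, LinearMap.trace_comp_comm', LinearMap.comp_assoc, ← LinearMap.mulRight_mul,
      map_inv_mul_map, LinearMap.mulRight_one, LinearMap.comp_id]
  have h4 : ∑ m : M, LinearMap.mulRight K (ρ m * b * ρ m⁻¹) =
      ((Fintype.card M : K) * c b) • LinearMap.id := by
    ext x
    simp only [LinearMap.sum_apply, LinearMap.mulRight_apply,
      ← Finset.mul_sum, ← conjSum_apply (K := K), hc, LinearMap.smul_apply, mul_smul_comm,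
      mul_one, LinearMap.id_apply]
  have h5 := congrArg (LinearMap.trace K B) h4
  rw [map_sum, Finset.sum_congr rfl fun m _ => key m, map_smul, LinearMap.trace_id] at h5
  rw [Finset.sum_const, Finset.card_univ, nsmul_eq_mul] at h5
  rw [h5, smul_eq_mul]; ring

theorem trace_mulLeft_mulRight' (a b : B) :
    LinearMap.trace K B (LinearMap.mulLeft K a ∘ₗ LinearMap.mulRight K b) =
      Module.finrank K B * (c a * c b) := by
  rw [trace_mulLeft_mulRight hc, trace_mulRight hc]; ring

omit [Module.Finite K B] in
theorem average_one [Nontrivial B] : c 1 = 1 := by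
  have h2 : (Fintype.card M : K) ≠ 0 := by simp
  have h1 := hc 1
  rw [conjSum_of_central (fun b => by simp)] at h1
  have h3 : (Fintype.card M : K) = Fintype.card M * c 1 :=
    FaithfulSMul.algebraMap_injective K B (by rwa [Algebra.algebraMap_eq_smul_one,
      Algebra.algebraMap_eq_smul_one])
  exact mul_left_cancel₀ h2 (by rw [← h3, mul_one])

/-- The projection onto the scalars has trace one, which evaluates the sum of `c m * c m⁻¹`. -/
theorem finrank_mul_sum [Nontrivial B] :
    (Module.finrank K B : K) * ∑ m : M, c (ρ m) * c (ρ m⁻¹) = Fintype.card M := by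
  have h2 : (Fintype.card M : K) ≠ 0 := by simp
  have h4 : conjSum (K := K) ρ =
      ∑ m : M, LinearMap.mulLeft K (ρ m) ∘ₗ LinearMap.mulRight K (ρ m⁻¹) := by
    ext x; simp [conjSum_apply, mul_assoc]
  have h5 : conjSum (K := K) ρ =
      (Fintype.card M : K) • (Algebra.linearMap K B ∘ₗ c) := by
    ext x; simp [hc, Algebra.algebraMap_eq_smul_one, smul_smul]
  have h6 := congrArg (LinearMap.trace K B) (h4.symm.trans h5)
  rw [map_sum, Finset.sum_congr rfl fun m _ => trace_mulLeft_mulRight' hc _ _, map_smul,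
    LinearMap.trace_comp_comm', ← Finset.mul_sum] at h6
  have h7 : c ∘ₗ Algebra.linearMap K B = LinearMap.id := by
    ext; simp [average_one hc]
  rw [h6, h7]; simp

end Trace

section Degree

variable {K : Type*} [Field K] [CharZero K] {B : Type*} [Ring B] [Algebra K B] [Nontrivial B]
  [Module.Finite K B] [Algebra.IsCentral K B] {Q : Type*} [Group Q] [Fintype Q] (ρ : Q →* B)

omit [CharZero K] [Module.Finite K B] [Algebra.IsCentral K B] in
theorem isIntegral_card_mul_average {c : B →ₗ[K] K}
    (hc : ∀ x, conjSum (K := K) ρ x = ((Fintype.card Q : K) * c x) • (1 : B)) (q : Q) :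
    IsIntegral ℤ ((Fintype.card Q : K) * c (ρ q)) := by
  set φ : MonoidAlgebra ℤ Q →ₐ[ℤ] B := MonoidAlgebra.lift ℤ B Q ρ
  have h1 : IsIntegral ℤ (φ (∑ m : Q, MonoidAlgebra.of ℤ Q (m * q * m⁻¹))) :=
    (IsIntegral.of_finite ℤ _).map φ
  have h2 : φ (∑ m : Q, MonoidAlgebra.of ℤ Q (m * q * m⁻¹)) =
      algebraMap K B ((Fintype.card Q : K) * c (ρ q)) := by
    rw [Algebra.algebraMap_eq_smul_one, ← hc, map_sum, conjSum_apply]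
    refine Finset.sum_congr rfl fun m _ => ?_
    rw [MonoidAlgebra.lift_of, map_mul, map_mul]
  rw [h2] at h1
  exact (isIntegral_algHom_iff ((Algebra.ofId K B).restrictScalars ℤ)
    (FaithfulSMul.algebraMap_injective K B)).1 h1

/-- A central algebra spanned by a `p`-group has `p`-power dimension. -/
theorem finrank_eq_pow {p : ℕ} (hp : p.Prime) (hQ : IsPGroup p Q)
    (hρ : Submodule.span K (Set.range ρ) = ⊤) : ∃ k, Module.finrank K B = p ^ k := by
  obtain ⟨c, hc⟩ := exists_average ρ hρ
  have := Fact.mk hp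
  obtain ⟨a, ha⟩ := IsPGroup.iff_card.1 hQ
  rw [Nat.card_eq_fintype_card] at ha
  have hd : (Module.finrank K B : K) ≠ 0 := by exact_mod_cast Module.finrank_pos.ne'
  set n := Fintype.card Q
  set d := Module.finrank K B
  have h1 : (algebraMap ℚ K) ((n : ℚ) ^ 3 / d) =
      ∑ m : Q, ((n : K) * c (ρ m)) * ((n : K) * c (ρ m⁻¹)) := by
    have h := finrank_mul_sum hc
    have h' : ∑ m : Q, c (ρ m) * c (ρ m⁻¹) = (n : K) / d := by
      rw [eq_div_iff hd, mul_comm]; exact h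
    have h'' : ∑ m : Q, ((n : K) * c (ρ m)) * ((n : K) * c (ρ m⁻¹)) =
        (n : K) ^ 2 * ∑ m : Q, c (ρ m) * c (ρ m⁻¹) := by
      rw [Finset.mul_sum]; exact Finset.sum_congr rfl fun m _ => by ring
    rw [h'', h']
    simp; ring
  have h2 : IsIntegral ℤ ((algebraMap ℚ K) ((n : ℚ) ^ 3 / d)) := by
    rw [h1]
    exact IsIntegral.sum _ fun m _ =>
      (isIntegral_card_mul_average ρ hc m).mul (isIntegral_card_mul_average ρ hc m⁻¹)
  rw [isIntegral_algebraMap_iff (algebraMap ℚ K).injective, IsIntegrallyClosed.isIntegral_iff] at h2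
  obtain ⟨y, hy⟩ := h2
  have hd' : (d : ℚ) ≠ 0 := by exact_mod_cast Module.finrank_pos.ne'
  rw [eq_div_iff hd'] at hy
  have h3 : (d : ℤ) ∣ (n : ℤ) ^ 3 := ⟨y, by
    rw [eq_intCast] at hy
    rw [mul_comm]; exact_mod_cast hy.symm⟩
  have h4 : d ∣ p ^ (a * 3) := by
    rw [pow_mul, ← ha]; exact_mod_cast h3
  obtain ⟨k, -, hk⟩ := (Nat.dvd_prime_pow hp).1 h4
  exact ⟨k, hk⟩

end Degree

theorem trace_mem_of_pow_eq_one {K F V : Type*} [Field K] [Field F] [Algebra K F]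
    [AddCommGroup V] [Module F V] [Module.Finite F V] {n : ℕ} {ζ : K}
    (hζ : IsPrimitiveRoot ζ n) (hn : 0 < n) (T : V →ₗ[F] V) (hT : T ^ n = 1) :
    ∃ k : K, algebraMap K F k = LinearMap.trace F V T := by
  set b := Module.finBasis F V
  set A := LinearMap.toMatrix b b T with hA
  have hAn : A ^ n = 1 := by
    rw [hA, LinearMap.toMatrix_pow, hT]; exact LinearMap.toMatrix_one b
  set E := AlgebraicClosure F
  set A' := (algebraMap F E).mapMatrix A with hA'
  have hAn' : A' ^ n = 1 := by rw [hA', ← map_pow, hAn, map_one]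
  have hζE : IsPrimitiveRoot (algebraMap K E ζ) n :=
    hζ.map_of_injective (algebraMap K E).injective
  have hroots : ∀ μ ∈ A'.charpoly.roots, μ ∈ (algebraMap K E).range := by
    intro μ hμ
    have h1 := Matrix.mem_spectrum_iff_isRoot_charpoly.2 (Polynomial.isRoot_of_mem_roots hμ)
    have h2 := spectrum.pow_mem_pow A' n h1
    rw [hAn', Matrix.mem_spectrum_iff_isRoot_charpoly, Matrix.charpoly_one] at h2
    have h3 : μ ^ n = 1 := by
      have h4 : (μ ^ n - 1) ^ Fintype.card (Fin (Module.finrank F V)) = 0 := by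
        simpa [Polynomial.IsRoot] using h2
      exact sub_eq_zero.1 (eq_zero_of_pow_eq_zero h4)
    have : NeZero n := ⟨hn.ne'⟩
    obtain ⟨i, -, hi⟩ := hζE.eq_pow_of_pow_eq_one h3
    exact ⟨ζ ^ i, by rw [map_pow, hi]⟩
  have htr : A'.trace ∈ (algebraMap K E).range := by
    rw [Matrix.trace_eq_sum_roots_charpoly]
    exact multiset_sum_mem _ hroots
  obtain ⟨k, hk⟩ := htr
  refine ⟨k, (algebraMap F E).injective ?_⟩
  rw [← IsScalarTower.algebraMap_apply, hk, hA', LinearMap.trace_eq_matrix_trace F b T]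
  exact (AddMonoidHom.map_trace (algebraMap F E) A).symm

section Center

theorem range_le_of_span {K F B : Type*} [Field K] [Field F] [CharZero F] [Algebra K F]
    [Ring B] [Nontrivial B] [Algebra K B] [Algebra F B] [IsScalarTower K F B]
    [Module.Finite F B] [Algebra.IsCentral F B]
    {Q : Type*} [Group Q] [Finite Q] {p : ℕ} (hQ : IsPGroup p Q)
    (hp : p.Prime) (hK : ∀ a : ℕ, ∃ ζ : K, IsPrimitiveRoot ζ (p ^ a)) (ρ : Q →* B)
    (hρ : Submodule.span K (Set.range ρ) = ⊤) (z : F) : z ∈ (algebraMap K F).range := by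
  have := Fintype.ofFinite Q
  have hρ' : Submodule.span F (Set.range ρ) = ⊤ := by
    refine eq_top_iff.2 fun x _ => ?_
    have hx : x ∈ Submodule.span K (Set.range ρ) := by rw [hρ]; trivial
    exact Submodule.span_le_restrictScalars K F _ hx
  obtain ⟨c, hc⟩ := exists_average ρ hρ'
  have hd : (Module.finrank F B : F) ≠ 0 := by exact_mod_cast Module.finrank_pos.ne'
  have h1 : ∀ q, c (ρ q) ∈ (algebraMap K F).range := fun q => by
    obtain ⟨a, ha⟩ := hQ q
    obtain ⟨ζ, hζ⟩ := hK a
    obtain ⟨k, hk⟩ := trace_mem_of_pow_eq_one (F := F) hζ (pow_pos hp.pos a)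
      (LinearMap.mulRight F (ρ q)) (by
        rw [LinearMap.pow_mulRight, ← map_pow, ha, map_one, LinearMap.mulRight_one]; rfl)
    rw [trace_mulRight hc] at hk
    refine ⟨k / (Module.finrank F B : K), ?_⟩
    rw [map_div₀, hk, map_natCast, mul_div_cancel_left₀ _ hd]
  have h2 : ∀ x, c x ∈ (algebraMap K F).range := fun x => by
    have hx : x ∈ Submodule.span K (Set.range ρ) := by rw [hρ]; trivial
    induction hx using Submodule.span_induction with
    | mem x hx => obtain ⟨q, rfl⟩ := hx; exact h1 q
    | zero => simp
    | add x y _ _ hx hy => rw [map_add]; exact add_mem hx hy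
    | smul a x _ hx =>
      rw [← algebraMap_smul F a x, map_smul]
      exact mul_mem ⟨a, rfl⟩ hx
  have h3 := h2 (algebraMap F B z)
  rwa [Algebra.algebraMap_eq_smul_one, map_smul, average_one hc, smul_eq_mul, mul_one] at h3

/-- A simple algebra spanned by a `p`-group is central once the field has all `p`-power roots of
unity. -/
theorem isCentral_of_span {K B : Type*} [Field K] [CharZero K] [Ring B] [IsSimpleRing B]
    [Algebra K B] [Module.Finite K B] {Q : Type*} [Group Q] [Finite Q] {p : ℕ}
    (hQ : IsPGroup p Q) (hp : p.Prime) (hK : ∀ a : ℕ, ∃ ζ : K, IsPrimitiveRoot ζ (p ^ a))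
    (ρ : Q →* B) (hρ : Submodule.span K (Set.range ρ) = ⊤) : Algebra.IsCentral K B := by
  let F := Subring.center B
  let _ : Field F := (IsSimpleRing.isField_center B).toField
  let _ : Algebra K F := RingHom.toAlgebra ((algebraMap K B).codRestrict F fun k =>
    Subring.mem_center_iff.2 fun b => (Algebra.commutes k b).symm)
  have : IsScalarTower K F B := IsScalarTower.of_algebraMap_eq fun _ => rfl
  have : CharZero F := charZero_of_injective_algebraMap (algebraMap K F).injective
  have : Module.Finite F B := Module.Finite.of_restrictScalars_finite K F B
  have : Algebra.IsCentral F B := ⟨fun z hz => by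
    rw [Subalgebra.mem_center_iff] at hz
    exact Algebra.mem_bot.2 ⟨⟨z, Subring.mem_center_iff.2 hz⟩, rfl⟩⟩
  refine ⟨fun z hz => ?_⟩
  rw [Subalgebra.mem_center_iff] at hz
  obtain ⟨k, hk⟩ := range_le_of_span hQ hp hK ρ hρ (⟨z, Subring.mem_center_iff.2 hz⟩ : F)
  exact Algebra.mem_bot.2 ⟨k, congrArg Subtype.val hk⟩

end Center

/-- The two-sided ideal of elements killed by a central element. -/
def annihilator {A : Type*} [Ring A] (e : A) (he : ∀ x, e * x = x * e) : TwoSidedIdeal A :=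
  TwoSidedIdeal.mk' {x | e * x = 0} (by simp)
    (fun {x y} hx hy => by
      simp only [Set.mem_ofPred_eq] at hx hy ⊢
      rw [mul_add, hx, hy, add_zero])
    (fun {x} hx => by
      simp only [Set.mem_ofPred_eq] at hx ⊢
      rw [mul_neg, hx, neg_zero])
    (fun {x y} hy => by
      simp only [Set.mem_ofPred_eq] at hy ⊢
      rw [← mul_assoc, he, mul_assoc, hy, mul_zero])
    (fun {x y} hx => by
      simp only [Set.mem_ofPred_eq] at hx ⊢
      rw [← mul_assoc, hx, zero_mul])

/-- A nonzero central idempotent of a finite-dimensional algebra survives as the identity of some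
simple quotient. -/
theorem exists_simple_quotient {K A : Type} [Field K] [Ring A] [Algebra K A] [Module.Finite K A]
    {e : A} (he : e * e = e) (hc : ∀ x, e * x = x * e) (h0 : e ≠ 0) :
    ∃ (B : Type) (_ : Ring B) (_ : Algebra K B) (π : A →ₐ[K] B),
      Module.Finite K B ∧ IsSimpleRing B ∧ Function.Surjective π ∧ π e = 1 := by
  let toSub : TwoSidedIdeal A → Submodule K A := fun I =>
    { carrier := I
      zero_mem' := I.zero_mem
      add_mem' := I.add_mem
      smul_mem' := fun k x hx => by
        rw [Algebra.smul_def]; exact I.mul_mem_left _ _ hx }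
  have hmem : ∀ I x, x ∈ toSub I ↔ x ∈ I := fun _ _ => Iff.rfl
  let S : Set (Submodule K A) := {s | ∃ I : TwoSidedIdeal A, 1 - e ∈ I ∧ (1 : A) ∉ I ∧ toSub I = s}
  have hS : S.Nonempty := ⟨_, annihilator e hc, by
    rw [annihilator, TwoSidedIdeal.mem_mk']; simp [mul_sub, he], by
    rw [annihilator, TwoSidedIdeal.mem_mk']; simpa using h0, rfl⟩
  obtain ⟨_, ⟨I, hI1, hI2, rfl⟩, hmax⟩ :=
    (wellFounded_gt : WellFounded ((· > ·) : Submodule K A → Submodule K A → Prop)).has_min S hS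
  let π : A →ₐ[K] I.ringCon.Quotient :=
    { I.ringCon.mk' with commutes' := fun _ => rfl }
  have hπs : Function.Surjective π := I.ringCon.mk'_surjective
  have hπ : ∀ x, π x = 0 ↔ x ∈ I := fun x => by
    rw [TwoSidedIdeal.mem_iff]; exact RingCon.eq I.ringCon
  have hπe : π e = 1 := by
    have := (hπ (1 - e)).2 hI1
    rw [map_sub, map_one, sub_eq_zero] at this
    exact this.symm
  have : Nontrivial I.ringCon.Quotient := ⟨1, 0, fun h => hI2 ((hπ 1).1 (by rw [map_one, h]))⟩
  refine ⟨I.ringCon.Quotient, inferInstance, inferInstance, π,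
    Module.Finite.of_surjective π.toLinearMap hπs, ?_, hπs, hπe⟩
  refine IsSimpleRing.of_eq_bot_or_eq_top fun J => ?_
  by_cases h1 : (1 : I.ringCon.Quotient) ∈ J
  · exact Or.inr (TwoSidedIdeal.one_mem_iff J |>.1 h1)
  · left
    have h2 : ∀ x, x ∈ TwoSidedIdeal.comap π J ↔ π x ∈ J := fun x => TwoSidedIdeal.mem_comap π
    have h3 : ¬ toSub (TwoSidedIdeal.comap π J) > toSub I := hmax _
      ⟨_, (h2 _).2 (by rw [map_sub, hπe, map_one, sub_self]; exact J.zero_mem),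
        fun h => h1 (by rw [h2, map_one] at h; exact h), rfl⟩
    have h4 : toSub I ≤ toSub (TwoSidedIdeal.comap π J) := fun x hx => by
      rw [hmem, h2, (hπ x).2 hx]; exact J.zero_mem
    have h5 := eq_of_le_of_not_lt h4 h3
    refine eq_bot_iff.2 fun y hy => ?_
    obtain ⟨x, rfl⟩ := hπs y
    rw [TwoSidedIdeal.mem_bot, hπ, ← hmem, h5, hmem, h2]
    exact hy

/-- A representation of `M` in a central simple algebra which is already spanned by a `p`-subgroup
and whose determinants all have `p`-power order. -/
structure IsGoodRep (p : ℕ) (K : Type) [Field K] {M : Type} [Group M] {B : Type} [Ring B]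
    [Algebra K B] (ρ : M →* B) : Prop where
  finite : Module.Finite K B
  simple : IsSimpleRing B
  central : Algebra.IsCentral K B
  span : ∃ Q : Subgroup M, IsPGroup p Q ∧ Submodule.span K (ρ '' Q) = ⊤
  det : ∀ (V : Type) [AddCommGroup V] [Module K V] [Module.Finite K V]
    (σ : B →ₐ[K] Module.End K V) (m : M), ∃ k : ℕ, LinearMap.det (σ (ρ m)) ^ p ^ k = 1

/-- `e` is a central idempotent generating the kernel complement of `π`. -/
structure IsKernelIdempotent {A B : Type*} [Ring A] [Ring B] (π : A → B) (e : A) : Prop where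
  idem : e * e = e
  comm : ∀ x, e * x = x * e
  map_one : π e = 1
  ker : ∀ x, π x = 0 → e * x = 0

/-- `e` is the central idempotent of a good representation. -/
def IsGood (p : ℕ) {K : Type} [Field K] {M : Type} [Group M] (e : MonoidAlgebra K M) : Prop :=
  ∃ (B : Type) (_ : Ring B) (_ : Algebra K B) (ρ : M →* B), IsGoodRep p K ρ ∧
    IsKernelIdempotent (MonoidAlgebra.lift K B M ρ) e

theorem lift_surjective {K M B : Type*} [Field K] [Monoid M] [Ring B] [Algebra K B] {ρ : M →* B}
    {S : Set M} (h : Submodule.span K (ρ '' S) = ⊤) :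
    Function.Surjective (MonoidAlgebra.lift K B M ρ) := by
  rw [← AlgHom.coe_toLinearMap, ← LinearMap.range_eq_top, eq_top_iff, ← h, Submodule.span_le]
  rintro _ ⟨m, -, rfl⟩
  exact ⟨MonoidAlgebra.of K M m, by simp⟩

/-- If a normal subgroup has `p`-power index, a `p`-subgroup of it extends to a `p`-subgroup
supplementing it. -/
theorem exists_supplement {p : ℕ} [Fact p.Prime] {L : Type*} [Group L] [Finite L]
    (N : Subgroup L) [N.Normal] (hN : IsPGroup p (L ⧸ N)) {Q : Subgroup L} (hQ : IsPGroup p Q) :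
    ∃ P : Subgroup L, IsPGroup p P ∧ Q ≤ P ∧ ∀ l : L, ∃ q ∈ P, ∃ n ∈ N, q * n = l := by
  obtain ⟨P, hP⟩ := hQ.exists_le_sylow
  refine ⟨P, P.2, hP, fun l => ?_⟩
  have h1 : (↑P ⊔ N : Subgroup L).index ∣ (P : Subgroup L).index :=
    Subgroup.index_dvd_of_le le_sup_left
  have h2 : (↑P ⊔ N : Subgroup L).index ∣ N.index := Subgroup.index_dvd_of_le le_sup_right
  obtain ⟨k, hk⟩ := IsPGroup.iff_card.1 hN
  have h3 : (↑P ⊔ N : Subgroup L).index = 1 := by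
    have h4 : Nat.Coprime (P : Subgroup L).index (p ^ k) :=
      ((Nat.Prime.coprime_iff_not_dvd Fact.out).2 P.not_dvd_index).symm.pow_right k
    rw [← hk] at h4
    exact Nat.eq_one_of_dvd_coprimes h4 h1 h2
  rw [Subgroup.index_eq_one] at h3
  have h5 : l ∈ (↑P ⊔ N : Subgroup L) := by rw [h3]; trivial
  rw [← SetLike.mem_coe, Subgroup.mul_normal] at h5
  obtain ⟨q, hq, n, hn, h⟩ := h5
  exact ⟨q, hq, n, hn, h⟩

theorem exists_algHom_factor {K A B C : Type*} [CommRing K] [Ring A] [Ring B] [Ring C]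
    [Algebra K A] [Algebra K B] [Algebra K C] (f : A →ₐ[K] B) (hf : Function.Surjective f)
    (g : A →ₐ[K] C) (h : ∀ x, f x = 0 → g x = 0) : ∃ φ : B →ₐ[K] C, ∀ x, φ (f x) = g x := by
  have key : ∀ x y, f x = f y → g x = g y := fun x y hxy => by
    rw [← sub_eq_zero, ← map_sub] at hxy ⊢; exact h _ hxy
  have hs : ∀ b, f (Function.surjInv hf b) = b := Function.surjInv_eq hf
  refine ⟨{ toFun := fun b => g (Function.surjInv hf b)
            map_one' := ?_, map_mul' := fun a b => ?_, map_zero' := ?_, map_add' := fun a b => ?_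
            commutes' := fun k => ?_ }, fun x => key _ _ (hs _)⟩
  · rw [← map_one g]; exact key _ _ (by rw [hs, map_one])
  · rw [← map_mul g]; exact key _ _ (by rw [hs, map_mul, hs, hs])
  · change g _ = 0
    rw [← map_zero g]; exact key _ _ (by rw [hs, map_zero])
  · change g _ = g _ + g _
    rw [← map_add g]; exact key _ _ (by rw [hs, map_add, hs, hs])
  · rw [← AlgHom.commutes g]; exact key _ _ (by rw [hs, AlgHom.commutes])

/-- The map of group algebras induced by a group homomorphism. -/
abbrev groupAlgebraMap (K : Type*) [Field K] {M L : Type*} [Group M] [Group L] (i : M →* L) :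
    MonoidAlgebra K M →ₐ[K] MonoidAlgebra K L :=
  MonoidAlgebra.lift K _ M ((MonoidAlgebra.of K L).comp i)

/-- Good idempotents extend across normal subgroups of `p`-power index. -/
theorem IsGood.exists_of_isPGroup {p : ℕ} (hp : p.Prime) {K : Type} [Field K] [CharZero K]
    (hK : ∀ a : ℕ, ∃ ζ : K, IsPrimitiveRoot ζ (p ^ a)) {M L : Type} [Group M] [Group L] [Finite L]
    (i : M →* L) [i.range.Normal] (hi : IsPGroup p (L ⧸ i.range)) {e : MonoidAlgebra K M}
    (he : IsGood p e) {f : MonoidAlgebra K L} (hf : f * f = f) (hfc : ∀ x, f * x = x * f)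
    (hf0 : f ≠ 0) (hfe : f * groupAlgebraMap K i e = f) :
    ∃ ε : MonoidAlgebra K L, IsGood p ε ∧ ε * f = ε := by
  have := Fact.mk hp
  have : Module.Finite K (MonoidAlgebra K L) :=
    inferInstance
  obtain ⟨B, _, _, ρ, hρ, hπ⟩ := he
  obtain ⟨B', _, _, π', hfin, hsimp, hsurj, hone⟩ := exists_simple_quotient (K := K) hf hfc hf0
  obtain ⟨Q, hQ, hspan⟩ := hρ.span
  obtain ⟨P, hP, hQP, hdec⟩ := exists_supplement i.range hi (hQ.map i)
  set ρ' : L →* B' := (π' : MonoidAlgebra K L →* B').comp (MonoidAlgebra.of K L) with hρ'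
  have hlift : MonoidAlgebra.lift K B' L ρ' = π' :=
    (MonoidAlgebra.lift_unique' π').symm
  have hone' : π' (groupAlgebraMap K i e) = 1 := by
    rw [← hone, ← hfe, map_mul, hone, one_mul]
  obtain ⟨φ, hφ⟩ := exists_algHom_factor (MonoidAlgebra.lift K B M ρ) (lift_surjective hspan)
    (π'.comp (groupAlgebraMap K i)) fun x hx => by
      have h := congrArg (fun y => π' (groupAlgebraMap K i y)) (hπ.ker x hx)
      simpa [hone'] using h
  have hφρ : ∀ m, φ (ρ m) = ρ' (i m) := fun m => by
    simpa [hρ'] using hφ (MonoidAlgebra.of K M m)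
  have hmul : ∀ q ∈ P, ∀ x ∈ Submodule.span K (ρ' '' P), ρ' q * x ∈ Submodule.span K (ρ' '' P) := by
    intro q hq x hx
    induction hx using Submodule.span_induction with
    | mem x hx =>
      obtain ⟨r, hr, rfl⟩ := hx
      exact Submodule.subset_span ⟨q * r, mul_mem hq hr, map_mul _ _ _⟩
    | zero => simp
    | add x y _ _ hx hy => rw [mul_add]; exact add_mem hx hy
    | smul a x _ hx => rw [mul_smul_comm]; exact Submodule.smul_mem _ _ hx
  have hφspan : ∀ b, φ b ∈ Submodule.span K (ρ' '' P) := fun b => by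
    have hb : b ∈ Submodule.span K (ρ '' Q) := by rw [hspan]; trivial
    induction hb using Submodule.span_induction with
    | mem x hx =>
      obtain ⟨r, hr, rfl⟩ := hx
      exact Submodule.subset_span ⟨i r, hQP ⟨r, hr, rfl⟩, (hφρ r).symm⟩
    | zero => simp
    | add x y _ _ hx hy => rw [map_add]; exact add_mem hx hy
    | smul a x _ hx => rw [map_smul]; exact Submodule.smul_mem _ _ hx
  have hPspan : Submodule.span K (ρ' '' P) = ⊤ := by
    have h1 : Submodule.span K (ρ' '' Set.univ) = ⊤ := by
      rw [Set.image_univ, eq_top_iff]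
      rintro b -
      obtain ⟨x, rfl⟩ := hsurj b
      induction x using MonoidAlgebra.induction_on with
      | of l => exact Submodule.subset_span ⟨l, rfl⟩
      | add x y hx hy => rw [map_add]; exact add_mem hx hy
      | smul a x hx => rw [map_smul]; exact Submodule.smul_mem _ _ hx
    rw [eq_top_iff, ← h1, Submodule.span_le]
    rintro _ ⟨l, -, rfl⟩
    obtain ⟨q, hq, _, ⟨m, rfl⟩, rfl⟩ := hdec l
    rw [map_mul, ← hφρ]
    exact hmul q hq _ (hφspan _)
  have hcent : Algebra.IsCentral K B' := by
    refine isCentral_of_span (ρ := ρ'.comp P.subtype) hP hp hK ?_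
    convert hPspan
    ext; simp
  obtain ⟨ε, h1, h2, h3, h4⟩ := exists_central_idempotent (MonoidAlgebra.lift K B' L ρ')
  refine ⟨ε, ⟨B', _, _, ρ', ⟨hfin, hsimp, hcent, ⟨P, hP, hPspan⟩, ?_⟩, h1, h2, h3, h4⟩, ?_⟩
  · intro V _ _ _ σ l
    obtain ⟨q, hq, _, ⟨m, rfl⟩, rfl⟩ := hdec l
    obtain ⟨k, hk⟩ := hρ.det V (σ.comp φ) m
    obtain ⟨j, hj⟩ := hP ⟨q, hq⟩
    have hj' : q ^ p ^ j = 1 := congrArg Subtype.val hj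
    refine ⟨j + k, ?_⟩
    have hk' : LinearMap.det (σ (ρ' (i m))) ^ p ^ k = 1 := by rw [← hφρ]; exact hk
    have hj'' : LinearMap.det (σ (ρ' q)) ^ p ^ j = 1 := by
      rw [← map_pow, ← map_pow, ← map_pow, hj', map_one, map_one, map_one]
    rw [map_mul, map_mul, map_mul, mul_pow, pow_add]
    nth_rw 1 [pow_mul]
    rw [hj'', one_pow, one_mul, mul_comm, pow_mul, hk', one_pow]
  · have h5 := h4 (1 - f) (by rw [hlift, map_sub, hone, map_one, sub_self])
    rw [mul_sub, mul_one, sub_eq_zero] at h5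
    exact h5.symm

theorem det_smul_of_linearEquiv_fun {K B V S : Type*} [Field K] [Ring B] [Algebra K B]
    [AddCommGroup V] [Module K V] [Module B V] [IsScalarTower K B V]
    [AddCommGroup S] [Module K S] [Module B S] [IsScalarTower K B S] [Module.Finite K S]
    {n : ℕ} (e : V ≃ₗ[B] Fin n → S) (a : B) :
    LinearMap.det (Algebra.lsmul K K V a) = LinearMap.det (Algebra.lsmul K K S a) ^ n := by
  have h1 : LinearMap.det (Algebra.lsmul K K (Fin n → S) a) =
      LinearMap.det (Algebra.lsmul K K S a) ^ n := by
    have h2 := LinearMap.det_pi (R := K) fun _ : Fin n => (Algebra.lsmul K K S a : S →ₗ[K] S)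
    rw [Finset.prod_const, Finset.card_univ, Fintype.card_fin] at h2
    rw [← h2]
    congr 1
  rw [← h1, ← LinearMap.det_conj _ (e.restrictScalars K)]
  congr 1
  refine LinearMap.ext fun x => ?_
  change e (a • e.symm x) = a • x
  rw [map_smul, e.apply_symm_apply]

/-- Over a simple algebra of `p`-power dimension, all determinants are controlled by the regular
one. -/
theorem exists_det_pow_eq {p : ℕ} (hp : p.Prime) {K B V : Type} [Field K] [Ring B] [IsSimpleRing B]
    [Algebra K B] [Module.Finite K B] {d : ℕ} (hd : Module.finrank K B = p ^ d)
    [AddCommGroup V] [Module K V] [Module.Finite K V] (σ : B →ₐ[K] Module.End K V) :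
    ∃ x j : ℕ, ∀ a : B, LinearMap.det (σ a) ^ p ^ j = LinearMap.det (LinearMap.mulLeft K a) ^ x := by
  let _ : Module B V := Module.compHom V σ.toRingHom
  have hsm : ∀ (b : B) (v : V), b • v = σ b v := fun _ _ => rfl
  have : IsScalarTower K B V := ⟨fun k b v => by simp [hsm]⟩
  have : IsArtinianRing B := IsArtinianRing.of_finite K B
  have : IsSemisimpleRing B := IsSimpleRing.isSemisimpleRing_iff_isArtinianRing.2 this
  have hiso := IsSimpleRing.isIsotypic B (V × B)
  obtain ⟨S, hS⟩ := IsAtomic.exists_atom (Submodule B (V × B))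
  rw [← isSimpleModule_iff_isAtom] at hS
  have : Module.Finite B V := Module.Finite.of_restrictScalars_finite K B V
  obtain ⟨x, ⟨eV⟩⟩ := ((hiso S).of_injective (LinearMap.inl B V B)
    LinearMap.inl_injective).linearEquiv_fun
  obtain ⟨y, ⟨eB⟩⟩ := ((hiso S).of_injective (LinearMap.inr B V B)
    LinearMap.inr_injective).linearEquiv_fun
  have : Module.Finite K S := Module.Finite.of_injective (S.subtype.restrictScalars K)
    S.injective_subtype
  have hy : y ∣ p ^ d := by
    rw [← hd, (eB.restrictScalars K).finrank_eq, Module.finrank_pi_fintype]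
    simp
  obtain ⟨j, -, rfl⟩ := (Nat.dvd_prime_pow hp).1 hy
  refine ⟨x, j, fun a => ?_⟩
  have h1 := det_smul_of_linearEquiv_fun (K := K) eV a
  have h2 := det_smul_of_linearEquiv_fun (K := K) eB a
  have h3 : LinearMap.det (σ a) = LinearMap.det (Algebra.lsmul K K V a) := rfl
  have h4 : LinearMap.det (LinearMap.mulLeft K a) = LinearMap.det (Algebra.lsmul K K B a) := rfl
  rw [h3, h4, h1, h2, ← pow_mul, ← pow_mul, mul_comm]

/-- An endomorphism of a central simple algebra spanned by a finite group, compatible with an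
automorphism of the group, is inner. -/
theorem exists_unit_intertwining {K B M : Type*} [Field K] [CharZero K] [Ring B] [IsSimpleRing B]
    [Algebra K B] [Module.Finite K B] [Algebra.IsCentral K B] [Group M] [Finite M] {ρ : M →* B}
    (hρ : Submodule.span K (Set.range ρ) = ⊤) (α : MulAut M) (φ : B →ₐ[K] B)
    (hφ : ∀ m, φ (ρ m) = ρ (α m)) : ∃ A : Bˣ, ∀ m, A * ρ m = ρ (α m) * A := by
  have := Fintype.ofFinite M
  obtain ⟨c, hc⟩ := exists_average ρ hρ
  have hn : (Fintype.card M : K) ≠ 0 := by simp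
  have hcα : ∀ m, c (ρ (α m)) = c (ρ m) := fun m => by
    have h1 : conjSum (K := K) ρ (ρ (α m)) = φ (conjSum (K := K) ρ (ρ m)) := by
      simp only [conjSum_apply, map_sum, map_mul, hφ, map_inv]
      exact (Equiv.sum_comp α.toEquiv fun k => ρ k * ρ (α m) * ρ k⁻¹).symm.trans (by simp)
    rw [hc, hc, map_smul, map_one] at h1
    have h2 : (Fintype.card M : K) * c (ρ (α m)) = Fintype.card M * c (ρ m) :=
      FaithfulSMul.algebraMap_injective K B (by
        rwa [Algebra.algebraMap_eq_smul_one, Algebra.algebraMap_eq_smul_one])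
    exact mul_left_cancel₀ hn h2
  set Φ : B →ₗ[K] B :=
    ∑ m : M, LinearMap.mulLeft K (ρ (α m)) ∘ₗ LinearMap.mulRight K (ρ m⁻¹) with hΦ
  have hΦx : ∀ x, Φ x = ∑ m : M, ρ (α m) * x * ρ m⁻¹ := fun x => by
    simp [hΦ, LinearMap.sum_apply, mul_assoc]
  have htr : LinearMap.trace K B Φ = Fintype.card M := by
    rw [hΦ, map_sum, ← finrank_mul_sum hc, Finset.mul_sum]
    refine Finset.sum_congr rfl fun m _ => ?_
    rw [trace_mulLeft_mulRight' hc, hcα]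
  obtain ⟨x, hx⟩ : ∃ x, Φ x ≠ 0 := by
    by_contra! h
    have hz : Φ = 0 := LinearMap.ext h
    rw [hz, map_zero] at htr
    exact hn htr.symm
  have htw : ∀ m, Φ x * ρ m = ρ (α m) * Φ x := fun k => by
    simp only [hΦx, Finset.mul_sum, Finset.sum_mul]
    rw [← Equiv.sum_comp (Equiv.mulLeft k) fun m => ρ (α m) * x * ρ m⁻¹ * ρ k]
    refine Finset.sum_congr rfl fun m _ => ?_
    simp only [Equiv.coe_mulLeft, mul_inv_rev, map_mul, mul_assoc, map_inv_mul_map, mul_one]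
  have htw' : ∀ b, Φ x * b = φ b * Φ x := fun b =>
    linearMap_eq_of_span hρ (f := LinearMap.mulLeft K (Φ x))
      (g := LinearMap.mulRight K (Φ x) ∘ₗ φ.toLinearMap) (fun m => by simp [hφ, htw]) b
  let J : TwoSidedIdeal B := TwoSidedIdeal.mk' {y | ∃ b, b * Φ x = y} ⟨0, by simp⟩
    (by rintro _ _ ⟨a, rfl⟩ ⟨b, rfl⟩; exact ⟨a + b, add_mul _ _ _⟩)
    (by rintro _ ⟨a, rfl⟩; exact ⟨-a, by simp⟩)
    (by rintro a _ ⟨b, rfl⟩; exact ⟨a * b, mul_assoc _ _ _⟩)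
    (by rintro _ a ⟨b, rfl⟩; exact ⟨b * φ a, by rw [mul_assoc, ← htw', mul_assoc]⟩)
  have hJ : (1 : B) ∈ J := IsSimpleRing.one_mem_of_ne_zero_mem J hx (by
    rw [TwoSidedIdeal.mem_mk']; exact ⟨1, one_mul _⟩)
  rw [TwoSidedIdeal.mem_mk'] at hJ
  obtain ⟨b, hb⟩ := hJ
  have : IsArtinianRing B := IsArtinianRing.of_finite K B
  have hb' : Φ x * b = 1 := mul_eq_one_symm hb
  exact ⟨⟨Φ x, b, hb', hb⟩, htw⟩

/-- A conjugation invariant character of a normal subgroup of finite index has a power that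
extends to the whole group. -/
theorem exists_hom_eq_pow_index {Γ A : Type*} [Group Γ] [CommGroup A] (H : Subgroup Γ) [H.Normal]
    [H.FiniteIndex] (ϕ : H →* A)
    (hϕ : ∀ (g : Γ) (h : H), ϕ ⟨g⁻¹ * h * g, by
      simpa using Subgroup.Normal.conj_mem ‹_› h.1 h.2 g⁻¹⟩ = ϕ h) :
    ∃ τ : Γ →* A, ∀ h : H, τ h = ϕ h ^ H.index := by
  refine ⟨MonoidHom.transfer ϕ, fun h => ?_⟩
  let T : H.LeftTransversal := default
  rw [MonoidHom.transfer_def ϕ T, Subgroup.leftTransversals.diff]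
  have hq : ∀ q : Γ ⧸ H, (h : Γ)⁻¹ • q = q := fun q => by
    induction q using QuotientGroup.induction_on with
    | _ z => 
      change ((↑((h : Γ)⁻¹ * z)) : Γ ⧸ H) = z
      rw [QuotientGroup.eq]
      simpa [mul_assoc] using Subgroup.Normal.conj_mem ‹_› h.1 h.2 z⁻¹
  let _ := H.fintypeQuotientOfFiniteIndex
  rw [Finset.prod_congr rfl fun q _ => (?_ : _ = ϕ h), Finset.prod_const, Finset.card_univ,
    Subgroup.index_eq_card, Nat.card_eq_fintype_card]
  rw [← hϕ (T.2.leftQuotientEquiv q : Γ) h]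
  refine congrArg ϕ (Subtype.ext ?_)
  have hT := Subgroup.smul_apply_eq_smul_apply_inv_smul (h : Γ) T q
  rw [hq] at hT
  change (T.2.leftQuotientEquiv q : Γ)⁻¹ * (((h : Γ) • T).2.leftQuotientEquiv q : Γ) =
    (T.2.leftQuotientEquiv q : Γ)⁻¹ * h * (T.2.leftQuotientEquiv q : Γ)
  rw [hT, smul_eq_mul, mul_assoc]

section Extension

variable {L M U C : Type*} [Group L] [Group M] [Group U] [CommGroup C]

/-- Pairs `(g, A)` such that `A` intertwines `ρ` with its conjugate by `g`. -/
def intertwiners (i : M →* L) [hi : i.range.Normal] (hinj : Function.Injective i)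
    (ρ : M →* U) : Subgroup (L × U) where
  carrier := {x | ∀ m m', i m' * x.1 = x.1 * i m → ρ m' * x.2 = x.2 * ρ m}
  one_mem' m m' hm := by
    have h : m' = m := hinj (by simpa using hm)
    simp [h]
  mul_mem' := by
    rintro ⟨g, A⟩ ⟨h, B⟩ hg hh m m' hm
    obtain ⟨n, hn⟩ := hi.conj_mem (i m) ⟨m, rfl⟩ h
    have h1 := hh m n (by simp [hn])
    have h2 := hg n m' (by
      simp only [Prod.mk_mul_mk] at hm ⊢
      rw [hn, ← mul_assoc, ← mul_assoc, eq_mul_inv_iff_mul_eq, mul_assoc, hm])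
    simp only [Prod.mk_mul_mk] at h1 h2 ⊢
    rw [← mul_assoc, h2, mul_assoc, h1, mul_assoc]
  inv_mem' := by
    rintro ⟨g, A⟩ hg m m' hm
    simp only [Prod.inv_mk] at hm ⊢
    have h1 := hg m' m (by
      rw [eq_inv_mul_iff_mul_eq, ← mul_assoc, mul_inv_eq_iff_eq_mul] at hm
      exact hm.symm)
    simp only at h1
    rw [eq_inv_mul_iff_mul_eq, ← mul_assoc, mul_inv_eq_iff_eq_mul, h1]

theorem exists_extension {p s c : ℕ} {i : M →* L} [hi : i.range.Normal] [i.range.FiniteIndex]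
    (hinj : Function.Injective i) (hcop : Nat.Coprime i.range.index p) {ρ : M →* U} {ι : C →* U}
    (hι : Function.Injective ι) (hιc : ∀ k A, ι k * A = A * ι k)
    (hcent : ∀ A, (∀ m, A * ρ m = ρ m * A) → ∃ k, ι k = A) (δ : U →* C)
    (hδι : ∀ k, δ (ι k) = k ^ p ^ s) (hδρ : ∀ m, δ (ρ m) ^ p ^ c = 1)
    (hex : ∀ g : L, ∃ A, (g, A) ∈ intertwiners i hinj ρ) :
    ∃ ρ' : L →* U, (∀ m, ρ' (i m) = ρ m) ∧ ∀ g, δ (ρ' g) ^ p ^ c = 1 := by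
  set Γ := intertwiners i hinj ρ with hΓ
  set ℓ := i.range.index with hℓ
  let pr : Γ →* L := (MonoidHom.fst L U).comp Γ.subtype
  let sn : Γ →* U := (MonoidHom.snd L U).comp Γ.subtype
  have hprs : Function.Surjective pr := fun g => let ⟨A, hA⟩ := hex g; ⟨⟨(g, A), hA⟩, rfl⟩
  have hext : ∀ γ γ' : Γ, pr γ = pr γ' → sn γ = sn γ' → γ = γ' := fun γ γ' h1 h2 =>
    Subtype.ext (Prod.ext h1 h2)
  have hΓm : ∀ (γ : Γ) m m', i m' * pr γ = pr γ * i m → ρ m' * sn γ = sn γ * ρ m := fun γ => γ.2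
  let ψ : M × C →* Γ :=
    { toFun := fun x => ⟨(i x.1, ρ x.1 * ι x.2), fun m m' h => by
        simp only [← map_mul] at h ⊢
        rw [← mul_assoc, ← map_mul, hinj h, map_mul, mul_assoc, mul_assoc, hιc]⟩
      map_one' := Subtype.ext (by simp)
      map_mul' := fun x y => Subtype.ext (Prod.ext (by simp) (by
        simp only [Prod.fst_mul, Prod.snd_mul, map_mul, Subgroup.coe_mul]
        rw [mul_assoc, mul_assoc, ← mul_assoc (ι x.2), hιc x.2 (ρ y.1), mul_assoc])) }
  have hψ1 : ∀ x, pr (ψ x) = i x.1 := fun _ => rfl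
  have hψ2 : ∀ x, sn (ψ x) = ρ x.1 * ι x.2 := fun _ => rfl
  have hψinj : Function.Injective ψ := fun x y h => by
    have h1 : x.1 = y.1 := hinj (by rw [← hψ1, ← hψ1, h])
    refine Prod.ext h1 (hι ?_)
    have h2 := hψ2 x
    rw [h, hψ2, h1] at h2
    exact (mul_left_cancel h2).symm
  set H := i.range.comap pr with hH
  have hHi : H.index = ℓ := Subgroup.index_comap_of_surjective _ hprs
  have hHfin : H.FiniteIndex := ⟨by rw [hHi]; exact Subgroup.FiniteIndex.index_ne_zero⟩
  have hψH : ∀ γ ∈ H, ∃ x, ψ x = γ := by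
    rintro γ ⟨m, hm⟩
    obtain ⟨k, hk⟩ := hcent ((ρ m)⁻¹ * sn γ) fun n => by
      have := hΓm γ n (m * n * m⁻¹) (by simp [← hm])
      simp only [map_mul, map_inv] at this
      rw [mul_assoc, ← this]
      group
    exact ⟨(m, k), hext _ _ (by rw [hψ1, hm]) (by rw [hψ2, hk, mul_inv_cancel_left])⟩
  let ψH : M × C →* H := ψ.codRestrict H fun x => ⟨x.1, rfl⟩
  have hψHv : ∀ x, (ψH x : Γ) = ψ x := fun _ => rfl
  let e : M × C ≃* H := MulEquiv.ofBijective ψH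
    ⟨fun x y h => hψinj (congrArg Subtype.val h), fun h =>
      let ⟨x, hx⟩ := hψH h h.2; ⟨x, Subtype.ext hx⟩⟩
  have he : ∀ x, e x = ψH x := fun _ => rfl
  let ϕ : H →* C := (MonoidHom.snd M C).comp e.symm.toMonoidHom
  have hϕ : ∀ x, ϕ (ψH x) = x.2 := fun x => by
    change (e.symm (ψH x)).2 = _
    rw [← he, e.symm_apply_apply]
  obtain ⟨τ, hτ⟩ := exists_hom_eq_pow_index H ϕ fun γ h => by
    obtain ⟨x, rfl⟩ := e.surjective h
    obtain ⟨n, hn⟩ := hi.conj_mem (i x.1) ⟨x.1, rfl⟩ (pr γ)⁻¹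
    rw [inv_inv] at hn
    have h1 := hΓm γ n x.1 (by rw [hn]; group)
    rw [he, hϕ, ← hϕ (n, x.2)]
    refine congrArg ϕ (Subtype.ext (hext _ _ ?_ ?_))
    · simp only [hψHv, map_mul, map_inv, hψ1, hn]
    · simp only [hψHv, map_mul, map_inv, hψ2]
      rw [mul_assoc, mul_assoc, hιc, ← mul_assoc (ρ x.1), h1]
      group
  have hτψ : ∀ x, τ (ψ x) = x.2 ^ ℓ := fun x => by rw [← hψHv, hτ, hϕ, hHi]
  have hbez : IsCoprime ((p ^ c * p ^ s : ℕ) : ℤ) ((ℓ ^ 2 : ℕ) : ℤ) :=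
    Nat.isCoprime_iff_coprime.2 (by
      rw [← pow_add]; exact (hcop.symm.pow_right 2).pow_left _)
  obtain ⟨x, y, hxy⟩ := hbez
  let f : Γ →* C := (δ.comp sn) ^ (x * (p ^ c : ℕ)) * τ ^ (y * ℓ)
  have hf : ∀ γ, f γ = δ (sn γ) ^ (x * (p ^ c : ℕ)) * τ γ ^ (y * ℓ) := fun _ => rfl
  have hfψ : ∀ z, f (ψ z) = z.2 := fun z => by
    rw [hf, hψ2, hτψ, map_mul, hδι, mul_zpow, mul_comm x, zpow_mul, zpow_natCast, hδρ, one_zpow,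
      one_mul, ← zpow_natCast, ← zpow_natCast, ← zpow_mul, ← zpow_mul, ← zpow_add]
    conv_rhs => rw [← zpow_one z.2, ← hxy]
    congr 1
    push_cast
    ring
  let q : f.ker →* L := pr.comp f.ker.subtype
  have hq : Function.Bijective q := by
    refine ⟨(injective_iff_map_eq_one q).2 fun u hu => ?_, fun g => ?_⟩
    · have hu' : pr u.1 = 1 := hu
      obtain ⟨z, hz⟩ := hψH u.1 ⟨1, by rw [hu', map_one]⟩
      have h1 : z.2 = 1 := by rw [← hfψ, hz]; exact u.2
      have h2 : z.1 = 1 := hinj (by rw [← hψ1, hz, hu', map_one])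
      refine Subtype.ext ?_
      rw [← hz, show z = 1 from Prod.ext h2 h1, map_one, Subgroup.coe_one]
    · obtain ⟨γ, rfl⟩ := hprs g
      refine ⟨⟨γ * ψ (1, (f γ)⁻¹), ?_⟩, ?_⟩
      · rw [MonoidHom.mem_ker, map_mul, hfψ, mul_inv_cancel]
      · change pr (γ * ψ (1, (f γ)⁻¹)) = pr γ
        rw [map_mul, hψ1, map_one, mul_one]
  let E : f.ker ≃* L := MulEquiv.ofBijective q hq
  have hE : ∀ u, E u = pr u.1 := fun _ => rfl
  let ρ' : L →* U := (sn.comp f.ker.subtype).comp E.symm.toMonoidHom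
  have hρ' : ∀ u, ρ' (E u) = sn u.1 := fun u => by
    change sn (E.symm (E u)).1 = _
    rw [E.symm_apply_apply]
  refine ⟨ρ', fun m => ?_, fun g => ?_⟩
  · have hm : f (ψ (m, 1)) = 1 := hfψ _
    have h1 := hρ' ⟨ψ (m, 1), hm⟩
    rw [hE, hψ1, hψ2, map_one, mul_one] at h1
    exact h1
  · obtain ⟨u, rfl⟩ := E.surjective g
    rw [hρ']
    have hfu : f u.1 = 1 := u.2
    obtain ⟨z, hz⟩ := hψH (u.1 ^ ℓ) (by rw [← hHi]; exact H.pow_index_mem u.1)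
    have h1 : z.2 = 1 := by rw [← hfψ, hz, map_pow, hfu, one_pow]
    have h2 : τ u.1 ^ ℓ = 1 := by rw [← map_pow, ← hz, hτψ, h1, one_pow]
    have h3 : (δ (sn u.1) ^ p ^ c) ^ ℓ = 1 := by
      rw [← pow_mul, mul_comm, pow_mul, ← map_pow δ, ← map_pow sn, ← hz, hψ2, h1, map_one, mul_one, hδρ]
    have h4 : (δ (sn u.1) ^ p ^ c) ^ x = 1 := by
      have h5 := hf u.1
      rw [hfu, mul_comm y, zpow_mul (τ u.1), zpow_natCast, h2, one_zpow, mul_one, mul_comm x,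
        zpow_mul, zpow_natCast] at h5
      exact h5.symm
    rw [← zpow_one (δ (sn u.1) ^ p ^ c), ← hxy, zpow_add]
    have h7 : y * ((ℓ ^ 2 : ℕ) : ℤ) = ℓ * (y * ℓ) := by push_cast; ring
    rw [h7, zpow_mul, h4, one_zpow, one_mul, zpow_mul, zpow_natCast, h3, one_zpow]

end Extension

theorem groupAlgebraMap_injective (K : Type*) [Field K] {M L : Type*} [Group M] [Group L]
    {i : M →* L} (hi : Function.Injective i) : Function.Injective (groupAlgebraMap K i) := by
  have h : groupAlgebraMap K i = MonoidAlgebra.mapDomainAlgHom K K i := by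
    ext; simp
  rw [h]
  exact MonoidAlgebra.mapDomain_injective hi

/-- Invariant good idempotents extend across normal subgroups of index prime to `p`. -/
theorem IsGood.exists_of_coprime {p : ℕ} (hp : p.Prime) {K : Type} [Field K] [CharZero K]
    {M L : Type} [Group M] [Group L] [Finite L]
    (i : M →* L) (hinj : Function.Injective i) [hn : i.range.Normal]
    (hi : Nat.Coprime i.range.index p) {e : MonoidAlgebra K M} (he : IsGood p e)
    (hinv : ∀ g : L, MonoidAlgebra.of K L g * groupAlgebraMap K i e =
      groupAlgebraMap K i e * MonoidAlgebra.of K L g) :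
    ∃ ε : MonoidAlgebra K L, IsGood p ε ∧ ε * groupAlgebraMap K i e = ε := by
  have : Finite M := Finite.of_injective i hinj
  have := Fintype.ofFinite M
  obtain ⟨B, _, _, ρ, hρ, hπ⟩ := he
  obtain ⟨hfin, hsimp, hcen, ⟨Q, hQ, hspan⟩, hdet⟩ := hρ
  have hspanM : Submodule.span K (Set.range ρ) = ⊤ := by
    rw [eq_top_iff, ← hspan]
    exact Submodule.span_mono (Set.image_subset_range _ _)
  have := Fintype.ofFinite Q
  obtain ⟨s, hs⟩ := finrank_eq_pow (K := K) (ρ := ρ.comp Q.subtype) hp hQ (by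
    convert hspan
    ext; simp)
  let ρu : M →* Bˣ := ρ.toHomUnits
  have hρu : ∀ m, (ρu m : B) = ρ m := fun _ => rfl
  let ι : Kˣ →* Bˣ := Units.map (algebraMap K B : K →* B)
  have hι : ∀ k, (ι k : B) = algebraMap K B k := fun _ => rfl
  let δ₀ : B →* K := LinearMap.det.comp (Algebra.lmul K B : B →* Module.End K B)
  have hδ₀ : ∀ b, δ₀ b = LinearMap.det (LinearMap.mulLeft K b) := fun _ => rfl
  let δ : Bˣ →* Kˣ := Units.map δ₀
  have hδ : ∀ A, (δ A : K) = δ₀ A := fun _ => rfl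
  choose k hk using hdet B (Algebra.lmul K B)
  set c := ∑ m, k m with hc
  have hδρ : ∀ m, δ (ρu m) ^ p ^ c = 1 := fun m => Units.ext (by
    rw [Units.val_pow_eq_pow_val, hδ, hρu, hc, ← Finset.add_sum_erase _ _ (Finset.mem_univ m),
      pow_add, pow_mul, Units.val_one]
    have h1 : δ₀ (ρ m) ^ p ^ k m = 1 := hk m
    rw [h1, one_pow])
  have hexists : ∀ g : L, ∃ A, (g, A) ∈ intertwiners i hinj ρu := fun g => by
    let j : M ≃* i.range := MonoidHom.ofInjective hinj
    let α : MulAut M := (j.trans (MulAut.conjNormal g)).trans j.symm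
    have hα : ∀ m, i (α m) = g * i m * g⁻¹ := fun m => by
      change i (j.symm (MulAut.conjNormal g (j m))) = _
      have h1 : ∀ x, i (j.symm x) = x := fun x => by
        conv_rhs => rw [← j.apply_symm_apply x]
        rfl
      rw [h1, MulAut.conjNormal_apply]
      rfl
    set a := groupAlgebraMap K α.toMonoidHom with ha
    have hia : ∀ x, groupAlgebraMap K i (a x) * MonoidAlgebra.of K L g =
        MonoidAlgebra.of K L g * groupAlgebraMap K i x := fun x =>
      linearMap_eq_of_span (span_range_of K M)
        (f := LinearMap.mulRight K (MonoidAlgebra.of K L g) ∘ₗ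
          ((groupAlgebraMap K i).comp a).toLinearMap)
        (g := LinearMap.mulLeft K (MonoidAlgebra.of K L g) ∘ₗ (groupAlgebraMap K i).toLinearMap)
        (fun m => by
          have h1 : i (α m) * g = g * i m := by rw [hα, inv_mul_cancel_right]
          simp [ha, h1, MonoidAlgebra.single_mul_single]) x
    have hae : a e = e := groupAlgebraMap_injective K hinj (by
      have h1 := hia e
      rw [hinv] at h1
      have h2 := congrArg (· * MonoidAlgebra.of K L g⁻¹) h1
      simpa only [mul_assoc, map_mul_map_inv, mul_one] using h2)
    obtain ⟨φ, hφ⟩ := exists_algHom_factor (MonoidAlgebra.lift K B M ρ) (lift_surjective hspan)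
      ((MonoidAlgebra.lift K B M ρ).comp a) fun x hx => by
        rw [AlgHom.comp_apply, ← one_mul (MonoidAlgebra.lift K B M ρ (a x)), ← hπ.map_one]
        nth_rw 1 [← hae]
        rw [← map_mul, ← map_mul, hπ.ker x hx, map_zero, map_zero]
    obtain ⟨A, hA⟩ := exists_unit_intertwining hspanM α φ fun m => by
      simpa [ha] using hφ (MonoidAlgebra.of K M m)
    refine ⟨A, fun m m' hm => Units.ext ?_⟩
    have h1 : m' = α m := hinj (by rw [hα, eq_mul_inv_iff_mul_eq, hm])
    rw [h1]
    exact (hA m).symm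
  obtain ⟨ρ', hρ'1, hρ'2⟩ := exists_extension (p := p) (s := s) (c := c) hinj hi (ρ := ρu) (ι := ι)
    (Units.map_injective (FaithfulSMul.algebraMap_injective K B))
    (fun k A => Units.ext (Algebra.commutes _ _)) (fun A hA => by
      have h1 : ∀ b : B, b * A = A * b := fun b =>
        (linearMap_eq_of_span hspanM (f := LinearMap.mulLeft K (A : B))
          (g := LinearMap.mulRight K (A : B)) (fun m => congrArg Units.val (hA m)) b).symm
      obtain ⟨a, ha⟩ := (Algebra.IsCentral.mem_center_iff K).1 (Subalgebra.mem_center_iff.2 h1)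
      have ha0 : a ≠ 0 := fun h => A.ne_zero (by rw [ha, h, map_zero])
      exact ⟨Units.mk0 a ha0, Units.ext ha.symm⟩) δ (fun a => Units.ext (by
        rw [hδ, hι, hδ₀, Units.val_pow_eq_pow_val, ← hs]
        have : LinearMap.mulLeft K (algebraMap K B a) = (a : K) • LinearMap.id := by
          ext b; simp [Algebra.smul_def]
        rw [this, LinearMap.det_smul, LinearMap.det_id, mul_one])) hδρ hexists
  let σ : L →* B := (Units.coeHom B).comp ρ'
  have hσi : ∀ m, σ (i m) = ρ m := fun m => congrArg Units.val (hρ'1 m)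
  have hlift : ∀ x, MonoidAlgebra.lift K B L σ (groupAlgebraMap K i x) =
      MonoidAlgebra.lift K B M ρ x := fun x =>
    linearMap_eq_of_span (span_range_of K M)
      (f := ((MonoidAlgebra.lift K B L σ).comp (groupAlgebraMap K i)).toLinearMap)
      (g := (MonoidAlgebra.lift K B M ρ).toLinearMap) (fun m => by simp [hσi]) x
  obtain ⟨ε, h1, h2, h3, h4⟩ := exists_central_idempotent (MonoidAlgebra.lift K B L σ)
  refine ⟨ε, ⟨B, _, _, σ, ⟨hfin, hsimp, hcen, ⟨Q.map i, hQ.map i, ?_⟩, ?_⟩, h1, h2, h3, h4⟩, ?_⟩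
  · rw [← hspan]
    congr 1
    ext b
    simp [hσi]
  · intro V _ _ _ θ g
    obtain ⟨x, j, hxj⟩ := exists_det_pow_eq hp hs θ
    refine ⟨j + c, ?_⟩
    rw [pow_add, pow_mul, hxj, ← pow_mul, mul_comm, pow_mul]
    have h5 : LinearMap.det (LinearMap.mulLeft K (σ g)) ^ p ^ c = 1 :=
      congrArg Units.val (hρ'2 g)
    rw [h5, one_pow]
  · have h5 := h4 (1 - groupAlgebraMap K i e) (by rw [map_sub, hlift, hπ.map_one, map_one, sub_self])
    rw [mul_sub, mul_one, sub_eq_zero] at h5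
    exact h5.symm

/-- The exponent of a chief factor of a `p`-solvable group is a power of `p` or prime to `p`. -/
theorem exists_pow_mem_of_chief {p : ℕ} {G : Type} [Group G] (hG : IsPSolvable p G)
    {M X : Subgroup G} [hM : M.Normal] [hX : X.Normal] (hMX : M < X)
    (hchief : ∀ Y : Subgroup G, Y.Normal → M ≤ Y → Y ≤ X → Y = M ∨ Y = X) :
    ∃ m : ℕ, ((∃ k, m = p ^ k) ∨ Nat.Coprime m p) ∧ ∀ g ∈ X, g ^ m ∈ M := by
  obtain ⟨n, H, h0, hn, hle, hnor, hcard⟩ := hG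
  let S : ℕ → Subgroup G := fun i => (H i ⊓ X) ⊔ M
  have hSX : ∀ i, S i ≤ X := fun i => sup_le inf_le_right hMX.le
  have hMS : ∀ i, M ≤ S i := fun i => le_sup_right
  have hS0 : S 0 ≠ X := by simpa [S, h0] using hMX.ne
  have hSn : S n = X := by simpa [S, hn] using hMX.le
  obtain ⟨i, hin, hi, hi'⟩ : ∃ i, i < n ∧ S i ≠ X ∧ S (i + 1) = X := by
    by_contra! hcon
    have : ∀ i, i ≤ n → S i ≠ X := fun i => by
      induction i with
      | zero => exact fun _ => hS0
      | succ i ih => exact fun h => hcon i h (ih (by omega))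
    exact this n le_rfl hSn
  have hcore : (S i).normalCore = M := by
    refine (hchief _ inferInstance (Subgroup.normal_le_normalCore.2 (hMS i))
      ((Subgroup.normalCore_le _).trans (hSX i))).resolve_right fun h => hi ?_
    exact le_antisymm (hSX i) (h ▸ Subgroup.normalCore_le _)
  have := hnor i hin
  refine ⟨Nat.card ((H (i + 1) : Subgroup G) ⧸ (H i).subgroupOf (H (i + 1))), ?_, ?_⟩
  · exact hcard i hin
  set m := Nat.card ((H (i + 1) : Subgroup G) ⧸ (H i).subgroupOf (H (i + 1))) with hm
  have key : ∀ x ∈ X, x ^ m ∈ S i := fun x hx => by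
    rw [← hi', ← SetLike.mem_coe, Subgroup.mul_normal] at hx
    obtain ⟨h, ⟨hh, hhX⟩, y, hy, rfl⟩ := hx
    have h1 : h ^ m ∈ H i :=
      Subgroup.pow_index_mem ((H i).subgroupOf (H (i + 1))) (⟨h, hh⟩ : H (i + 1))
    have h2 : (h ^ m)⁻¹ * (h * y) ^ m ∈ M := by
      rw [← QuotientGroup.eq]
      have h3 : ((h * y : G) : G ⧸ M) = h := QuotientGroup.mk_mul_of_mem h hy
      rw [QuotientGroup.mk_pow, QuotientGroup.mk_pow, h3]
    have h4 := mul_mem (Subgroup.mem_sup_left (T := M)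
      (show h ^ m ∈ H i ⊓ X from ⟨h1, pow_mem hhX m⟩)) (hMS i h2)
    rwa [mul_inv_cancel_left] at h4
  intro x hx
  rw [← hcore]
  intro g
  rw [← conj_pow]
  exact key _ (hX.conj_mem x hx g)

theorem isPGroup_or_coprime_index {p m : ℕ} (hp : p.Prime) {L : Type*} [Group L] [Finite L]
    (N : Subgroup L) [N.Normal] (hm : (∃ k, m = p ^ k) ∨ Nat.Coprime m p)
    (h : ∀ g : L, g ^ m ∈ N) : IsPGroup p (L ⧸ N) ∨ Nat.Coprime N.index p := by
  have h1 : ∀ x : L ⧸ N, x ^ m = 1 := fun x => by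
    induction x using QuotientGroup.induction_on with
    | _ g => rw [← QuotientGroup.mk_pow, QuotientGroup.eq_one_iff]; exact h g
  rcases hm with ⟨k, rfl⟩ | hm
  · exact Or.inl fun x => ⟨k, h1 x⟩
  · right
    rw [Nat.coprime_comm, hp.coprime_iff_not_dvd]
    intro hd
    have := Fact.mk hp
    obtain ⟨x, hx⟩ := exists_prime_orderOf_dvd_card' (G := L ⧸ N) p hd
    have h2 := orderOf_dvd_of_pow_eq_one (h1 x)
    rw [hx] at h2
    have h3 := Nat.dvd_gcd h2 (dvd_refl p)
    rw [hm] at h3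
    exact hp.one_lt.ne' (Nat.dvd_one.1 h3)

section Trunc

variable {K : Type} [Field K] {G : Type} [Group G]

theorem linearMap_ext_of {V : Type*} [AddCommGroup V] [Module K V]
    {f g : MonoidAlgebra K G →ₗ[K] V}
    (h : ∀ x, f (MonoidAlgebra.of K G x) = g (MonoidAlgebra.of K G x))
    (x : MonoidAlgebra K G) : f x = g x :=
  linearMap_eq_of_span (span_range_of K G) h x

/-- The inclusion of the group algebra of a subgroup. -/
abbrev subAlgebraMap (K : Type) [Field K] {G : Type} [Group G] (S : Subgroup G) :
    MonoidAlgebra K S →ₐ[K] MonoidAlgebra K G := groupAlgebraMap K S.subtype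

theorem subAlgebraMap_of (S : Subgroup G) (s : S) :
    subAlgebraMap K S (MonoidAlgebra.of K S s) = MonoidAlgebra.of K G s := by
  simp

theorem commute_subAlgebraMap {S : Subgroup G} {x : MonoidAlgebra K G}
    (h : ∀ s ∈ S, Commute (MonoidAlgebra.of K G s) x) (y : MonoidAlgebra K S) :
    Commute (subAlgebraMap K S y) x :=
  linearMap_eq_of_span (span_range_of K S)
    (f := LinearMap.mulRight K x ∘ₗ (subAlgebraMap K S).toLinearMap)
    (g := LinearMap.mulLeft K x ∘ₗ (subAlgebraMap K S).toLinearMap)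
    (fun s => by
      simp only [LinearMap.comp_apply, AlgHom.toLinearMap_apply, subAlgebraMap_of,
        LinearMap.mulRight_apply, LinearMap.mulLeft_apply]
      exact h s s.2) y

theorem subAlgebraMap_inclusion {S T : Subgroup G} (hST : S ≤ T) (x : MonoidAlgebra K S) :
    subAlgebraMap K T (groupAlgebraMap K (Subgroup.inclusion hST) x) = subAlgebraMap K S x :=
  linearMap_eq_of_span (span_range_of K S)
    (f := ((subAlgebraMap K T).comp (groupAlgebraMap K (Subgroup.inclusion hST))).toLinearMap)
    (g := (subAlgebraMap K S).toLinearMap) (fun s => by simp) x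

theorem subAlgebraMap_injective (S : Subgroup G) : Function.Injective (subAlgebraMap K S) :=
  groupAlgebraMap_injective K S.subtype_injective

variable [Fintype G]

/-- The part of an element of the group algebra which is supported on a subgroup. -/
def trunc (S : Subgroup G) : MonoidAlgebra K G →ₗ[K] MonoidAlgebra K G where
  toFun z := ∑ g : G, (if g ∈ S then z.coeff g else 0) • MonoidAlgebra.of K G g
  map_add' x y := by
    rw [← Finset.sum_add_distrib]
    refine Finset.sum_congr rfl fun g _ => ?_
    split_ifs <;> simp [add_smul]
  map_smul' c x := by
    rw [RingHom.id_apply, Finset.smul_sum]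
    refine Finset.sum_congr rfl fun g _ => ?_
    split_ifs <;> simp

theorem trunc_of (S : Subgroup G) (g : G) :
    trunc S (MonoidAlgebra.of K G g) = if g ∈ S then MonoidAlgebra.of K G g else 0 := by
  change ∑ h : G, (if h ∈ S then (MonoidAlgebra.of K G g).coeff h else 0) •
    MonoidAlgebra.of K G h = _
  rw [Finset.sum_eq_single g (fun h _ hh => ?_) (fun h => absurd (Finset.mem_univ _) h)]
  · split_ifs <;> simp
  · simp [hh.symm]

theorem trunc_trunc (S : Subgroup G) (z : MonoidAlgebra K G) : trunc S (trunc S z) = trunc S z :=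
  linearMap_ext_of (f := trunc S ∘ₗ trunc S) (fun g => by
    rw [LinearMap.comp_apply, trunc_of]
    split_ifs with h
    · rw [trunc_of, if_pos h]
    · rw [map_zero]) z

theorem trunc_top (z : MonoidAlgebra K G) : trunc ⊤ z = z :=
  linearMap_ext_of (g := LinearMap.id) (fun g => by
    rw [trunc_of, if_pos (Subgroup.mem_top g)]; rfl) z

theorem trunc_of_mul {S : Subgroup G} {s : G} (hs : s ∈ S) (z : MonoidAlgebra K G) :
    trunc S (MonoidAlgebra.of K G s * z) = MonoidAlgebra.of K G s * trunc S z :=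
  linearMap_ext_of (f := trunc S ∘ₗ LinearMap.mulLeft K (MonoidAlgebra.of K G s))
    (g := LinearMap.mulLeft K (MonoidAlgebra.of K G s) ∘ₗ trunc S) (fun g => by
      rw [LinearMap.comp_apply, LinearMap.comp_apply, LinearMap.mulLeft_apply,
        LinearMap.mulLeft_apply, ← map_mul, trunc_of, trunc_of, Subgroup.mul_mem_cancel_left _ hs]
      split_ifs <;> simp) z

theorem trunc_mul_of {S : Subgroup G} {s : G} (hs : s ∈ S) (z : MonoidAlgebra K G) :
    trunc S (z * MonoidAlgebra.of K G s) = trunc S z * MonoidAlgebra.of K G s :=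
  linearMap_ext_of (f := trunc S ∘ₗ LinearMap.mulRight K (MonoidAlgebra.of K G s))
    (g := LinearMap.mulRight K (MonoidAlgebra.of K G s) ∘ₗ trunc S) (fun g => by
      rw [LinearMap.comp_apply, LinearMap.comp_apply, LinearMap.mulRight_apply,
        LinearMap.mulRight_apply, ← map_mul, trunc_of, trunc_of,
        Subgroup.mul_mem_cancel_right _ hs]
      split_ifs <;> simp) z

theorem exists_subAlgebraMap_eq_trunc (S : Subgroup G) (z : MonoidAlgebra K G) :
    ∃ z₀, subAlgebraMap K S z₀ = trunc S z := by
  change trunc S z ∈ (subAlgebraMap K S).range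
  have h : trunc S z = ∑ g : G, (if g ∈ S then z.coeff g else 0) • MonoidAlgebra.of K G g := rfl
  rw [h]
  refine sum_mem fun g _ => ?_
  by_cases hg : g ∈ S
  · refine Subalgebra.smul_mem _ ?_ _
    exact (AlgHom.mem_range _).2 ⟨MonoidAlgebra.of K S ⟨g, hg⟩, subAlgebraMap_of S ⟨g, hg⟩⟩
  · rw [if_neg hg, zero_smul]; exact zero_mem _

theorem trunc_subAlgebraMap {S T : Subgroup G} (hST : S ≤ T) (x : MonoidAlgebra K S) :
    trunc T (subAlgebraMap K S x) = subAlgebraMap K S x :=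
  linearMap_eq_of_span (span_range_of K S)
    (f := trunc T ∘ₗ (subAlgebraMap K S).toLinearMap) (g := (subAlgebraMap K S).toLinearMap)
    (fun s => by
      rw [LinearMap.comp_apply, AlgHom.toLinearMap_apply, subAlgebraMap_of, trunc_of,
        if_pos (hST s.2)]) x

end Trunc

open MonoidAlgebra (of)

theorem IsGood.idem {p : ℕ} {K : Type} [Field K] {M : Type} [Group M] {e : MonoidAlgebra K M}
    (he : IsGood p e) : e * e = e := by
  obtain ⟨B, _, _, ρ, -, hπ⟩ := he
  exact hπ.idem

theorem IsGood.comm {p : ℕ} {K : Type} [Field K] {M : Type} [Group M] {e : MonoidAlgebra K M}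
    (he : IsGood p e) (x : MonoidAlgebra K M) : e * x = x * e := by
  obtain ⟨B, _, _, ρ, -, hπ⟩ := he
  exact hπ.comm x

theorem IsGood.ne_zero {p : ℕ} {K : Type} [Field K] {M : Type} [Group M] {e : MonoidAlgebra K M}
    (he : IsGood p e) : e ≠ 0 := by
  obtain ⟨B, _, _, ρ, hρ, hπ⟩ := he
  have := hρ.simple
  rintro rfl
  exact zero_ne_one ((map_zero _).symm.trans hπ.map_one)

theorem IsGood.exists_smul {p : ℕ} {K : Type} [Field K] {M : Type} [Group M]
    {e : MonoidAlgebra K M} (he : IsGood p e) {z : MonoidAlgebra K M} (hz : ∀ x, z * x = x * z) :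
    ∃ c : K, e * z = c • e := by
  obtain ⟨B, _, _, ρ, hρ, hπ⟩ := he
  obtain ⟨Q, -, hQ⟩ := hρ.span
  have := hρ.central
  set π := MonoidAlgebra.lift K B M ρ
  have h1 : π z ∈ Subalgebra.center K B := Subalgebra.mem_center_iff.2 fun b => by
    obtain ⟨x, rfl⟩ := lift_surjective hQ b
    change π x * π z = π z * π x
    rw [← map_mul, ← map_mul, hz]
  obtain ⟨c, hc⟩ := (Algebra.IsCentral.mem_center_iff K).1 h1
  refine ⟨c, ?_⟩
  have h2 := hπ.ker (z - algebraMap K _ c) (by rw [map_sub, hc, AlgHom.commutes, sub_self])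
  rw [mul_sub, sub_eq_zero] at h2
  rw [h2, Algebra.smul_def, Algebra.commutes]

section Completion

variable {p : ℕ} {K : Type} [Field K] {G : Type} [Group G]

theorem of_mul_of_inv (t : G) : of K G t * of K G t⁻¹ = 1 := map_mul_map_inv _ t

theorem of_inv_mul_of (t : G) : of K G t⁻¹ * of K G t = 1 := map_inv_mul_map _ t

variable [Fintype G]

/-- Distinct conjugates of a good idempotent are orthogonal. -/
theorem IsGood.mul_conj_eq_zero {M : Subgroup G} {e : MonoidAlgebra K M} (he : IsGood p e) {t : G}
    (ht : ∀ m, m ∈ M ↔ t * m * t⁻¹ ∈ M) (hte : ¬ Commute (of K G t) (subAlgebraMap K M e)) :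
    subAlgebraMap K M e * (of K G t * subAlgebraMap K M e * of K G t⁻¹) = 0 := by
  set a := subAlgebraMap K M e with ha
  have haa : a * a = a := by rw [ha, ← map_mul, he.idem]
  have ha0 : a ≠ 0 := fun h => he.ne_zero (subAlgebraMap_injective M (by rw [map_zero]; exact h))
  have hac : ∀ m ∈ M, Commute (of K G m) a := fun m hm => by
    have h := congrArg (subAlgebraMap K M) (he.comm (of K M ⟨m, hm⟩))
    rw [map_mul, map_mul, subAlgebraMap_of] at h
    exact h.symm
  have key : ∀ s : G, (∀ m, m ∈ M ↔ s * m * s⁻¹ ∈ M) →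
      (∀ m ∈ M, Commute (of K G m) (of K G s * a * of K G s⁻¹)) ∧
      ∃ c : K, a * (of K G s * a * of K G s⁻¹) = c • a := fun s hs => by
    have h1 : ∀ m ∈ M, Commute (of K G m) (of K G s * a * of K G s⁻¹) := fun m hm => by
      have h2 : s⁻¹ * m * s ∈ M := by rw [hs]; simpa [mul_assoc] using hm
      have h3 := (hac _ h2).eq
      have h4 : of K G m * of K G s = of K G s * of K G (s⁻¹ * m * s) := by
        rw [← map_mul, ← map_mul]; congr 1; group
      have h5 : of K G (s⁻¹ * m * s) * of K G s⁻¹ = of K G s⁻¹ * of K G m := by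
        rw [← map_mul, ← map_mul]; congr 1; group
      change of K G m * _ = _ * of K G m
      rw [← mul_assoc, ← mul_assoc, h4, mul_assoc (of K G s), h3, ← mul_assoc, mul_assoc _ _ (of K G s⁻¹), h5, ← mul_assoc]
    have h6 : trunc M (of K G s * a * of K G s⁻¹) = of K G s * a * of K G s⁻¹ :=
      linearMap_eq_of_span (span_range_of K M)
        (f := trunc M ∘ₗ LinearMap.mulRight K (of K G s⁻¹) ∘ₗ LinearMap.mulLeft K (of K G s) ∘ₗ
          (subAlgebraMap K M).toLinearMap)
        (g := LinearMap.mulRight K (of K G s⁻¹) ∘ₗ LinearMap.mulLeft K (of K G s) ∘ₗ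
          (subAlgebraMap K M).toLinearMap) (fun m => by
          simp only [LinearMap.comp_apply, AlgHom.toLinearMap_apply, subAlgebraMap_of,
            LinearMap.mulRight_apply, LinearMap.mulLeft_apply, ← map_mul]
          rw [trunc_of, if_pos ((hs m).1 m.2)]) e
    obtain ⟨z, hz⟩ := exists_subAlgebraMap_eq_trunc M (of K G s * a * of K G s⁻¹)
    rw [h6] at hz
    obtain ⟨c, hc⟩ := he.exists_smul (z := z) fun x => subAlgebraMap_injective M (by
      rw [map_mul, map_mul, hz]
      exact (commute_subAlgebraMap h1 x).symm)
    refine ⟨h1, c, ?_⟩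
    rw [← hz, ha, ← map_mul, hc, map_smul]
  obtain ⟨h1, c, hc⟩ := key t ht
  obtain ⟨-, d, hd⟩ := key t⁻¹ fun m => by rw [ht (t⁻¹ * m * t⁻¹⁻¹)]; simp [mul_assoc]
  set b := of K G t * a * of K G t⁻¹ with hb
  have hab : a * b = b * a := commute_subAlgebraMap h1 e
  have hba : b * a = d • b := by
    have h2 := congrArg (fun x => of K G t * x * of K G t⁻¹) hd
    simp only [inv_inv] at h2
    rw [mul_smul_comm, smul_mul_assoc, ← hb, hb] at h2
    rw [hb, ← h2]
    simp only [mul_assoc, of_mul_of_inv, mul_one]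
  by_cases hc0 : c = 0
  · rw [hc, hc0, zero_smul]
  exfalso
  have hcc : c * c = c := by
    have h3 : a * b * (a * b) = a * b := by
      have hbb : b * b = b := by
        rw [hb]
        simp only [mul_assoc]
        rw [← mul_assoc (of K G t⁻¹), of_inv_mul_of, one_mul, ← mul_assoc a a, haa]
      rw [mul_assoc, ← mul_assoc b, ← hab, mul_assoc a, hbb, ← mul_assoc, haa]
    rw [hc, smul_mul_smul_comm, haa] at h3
    exact smul_left_injective K ha0 h3
  have hc1 : c = 1 := by simpa [hc0] using hcc
  have h4 : a = d • b := by rw [← hba, ← hab, hc, hc1, one_smul]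
  have h5 : b = a := by
    have hd1 : a = d • a := by
      conv_lhs => rw [← haa]
      nth_rw 2 [h4]
      rw [mul_smul_comm, hc, hc1, one_smul]
    have hd2 : d = 1 := smul_left_injective K ha0 (by simpa using hd1.symm)
    rw [h4, hd2, one_smul]
  refine hte ?_
  change of K G t * a = a * of K G t
  conv_rhs => rw [← h5, hb]
  rw [mul_assoc, of_inv_mul_of, mul_one]

/-- An idempotent `ε` over `a` which sees every central element of the group algebra of `T` as a
scalar. -/
structure IsCompletion (T : Subgroup G) (a ε : MonoidAlgebra K G) : Prop where
  ne_zero : ε ≠ 0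
  idem : ε * ε = ε
  comm : ∀ t ∈ T, Commute (of K G t) ε
  absorb : ∀ u, (∀ t ∈ T, Commute (of K G t) u) → a * u = a → ε * u = ε
  scalar : ∀ z, trunc T z = z → (∀ t ∈ T, Commute (of K G t) z) → ∃ c : K, ε * z = c • ε

theorem IsCompletion.exists_of_stabilizer [CharZero K] {M T T' : Subgroup G}
    {e : MonoidAlgebra K M} (he : IsGood p e) (hMT : M ≤ T)
    (hn : ∀ t ∈ T, ∀ m, m ∈ M ↔ t * m * t⁻¹ ∈ M)
    (hT' : ∀ t, t ∈ T' ↔ t ∈ T ∧ Commute (of K G t) (subAlgebraMap K M e))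
    {ε : MonoidAlgebra K G} (hε : IsCompletion T' (subAlgebraMap K M e) ε) :
    ∃ f, IsCompletion T (subAlgebraMap K M e) f := by
  have horth := fun t ht => he.mul_conj_eq_zero (t := t) (hn t ht)
  set a := subAlgebraMap K M e with ha
  have haa : a * a = a := by rw [ha, ← map_mul, he.idem]
  have hac : ∀ m ∈ M, Commute (of K G m) a := fun m hm => by
    have h := congrArg (subAlgebraMap K M) (he.comm (of K M ⟨m, hm⟩))
    rw [map_mul, map_mul, subAlgebraMap_of] at h
    exact h.symm
  have hMT' : M ≤ T' := fun m hm => (hT' m).2 ⟨hMT hm, hac m hm⟩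
  have haT' : ∀ x, (∀ t ∈ T', Commute (of K G t) x) → a * x = x * a := fun x hx =>
    commute_subAlgebraMap (fun m hm => hx m (hMT' hm)) e
  have hεa : ε * a = ε := hε.absorb a (fun t ht => ((hT' t).1 ht).2) haa
  have haε : a * ε = ε := by rw [haT' ε hε.comm, hεa]
  have hata : ∀ t ∈ T, t ∉ T' → a * of K G t * a = 0 := fun t ht ht' => by
    have h := congrArg (· * of K G t) (horth t ht fun h => ht' ((hT' t).2 ⟨ht, h⟩))
    simpa only [mul_assoc, of_inv_mul_of, mul_one, zero_mul] using h
  have hn0 : (Nat.card T' : K) ≠ 0 := by exact_mod_cast Nat.card_pos.ne'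
  set f : MonoidAlgebra K G :=
    (Nat.card T' : K)⁻¹ • ∑ t : G, if t ∈ T then of K G t * ε * of K G t⁻¹ else 0 with hf
  have hfcomm : ∀ t ∈ T, Commute (of K G t) f := fun s hs => by
    change of K G s * f = f * of K G s
    rw [hf, mul_smul_comm, smul_mul_assoc, Finset.mul_sum, Finset.sum_mul]
    congr 1
    rw [← Equiv.sum_comp (Equiv.mulLeft s) fun t =>
      (if t ∈ T then of K G t * ε * of K G t⁻¹ else 0) * of K G s]
    refine Finset.sum_congr rfl fun t _ => ?_
    simp only [Equiv.coe_mulLeft, Subgroup.mul_mem_cancel_left _ hs]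
    split_ifs
    · simp only [mul_inv_rev, map_mul, mul_assoc, of_inv_mul_of, mul_one]
    · simp
  have haf : a * f = ε := by
    rw [hf, mul_smul_comm, Finset.mul_sum, inv_smul_eq_iff₀ hn0]
    have h1 : ∀ t : G, (a * if t ∈ T then of K G t * ε * of K G t⁻¹ else 0) =
        if t ∈ T' then ε else 0 := fun t => by
      by_cases ht' : t ∈ T'
      · rw [if_pos ht', if_pos ((hT' t).1 ht').1, (hε.comm t ht').eq, mul_assoc, of_mul_of_inv,
          mul_one, haε]
      · rw [if_neg ht']
        split_ifs with ht
        · rw [← haε]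
          simp only [← mul_assoc]
          rw [hata t ht ht', zero_mul, zero_mul]
        · rw [mul_zero]
    rw [Finset.sum_congr rfl fun t _ => h1 t, Finset.sum_ite, Finset.sum_const_zero, add_zero,
      Finset.sum_const, Nat.cast_smul_eq_nsmul, Nat.card_eq_fintype_card, Fintype.card_subtype]
  have hfy : ∀ (y : MonoidAlgebra K G) (c : K), (∀ t ∈ T, Commute (of K G t) y) →
      ε * y = c • ε → f * y = c • f := fun y c hy hc => by
    rw [hf, smul_mul_assoc, smul_comm c, Finset.sum_mul]
    congr 1
    rw [Finset.smul_sum]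
    refine Finset.sum_congr rfl fun t _ => ?_
    split_ifs with ht
    · rw [mul_assoc, (hy _ (inv_mem ht)).eq, ← mul_assoc, mul_assoc _ ε, hc, mul_smul_comm,
        smul_mul_assoc]
    · simp
  have hT'T : T' ≤ T := fun t ht => ((hT' t).1 ht).1
  refine ⟨f, ⟨fun h => hε.ne_zero (by rw [← haf, h, mul_zero]), ?_, hfcomm, ?_, ?_⟩⟩
  · have h := hfy f 1 hfcomm (by
      rw [one_smul]
      nth_rw 1 [← hεa]
      rw [mul_assoc, haf, hε.idem])
    rwa [one_smul] at h
  · intro u hu hau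
    have h := hfy u 1 hu (by
      rw [one_smul]; exact hε.absorb u (fun t ht => hu t (hT'T ht)) hau)
    rwa [one_smul] at h
  · intro z hz hzc
    have hz'c : ∀ t ∈ T', Commute (of K G t) (trunc T' z) := fun t ht => by
      change of K G t * _ = _ * of K G t
      rw [← trunc_of_mul ht, ← trunc_mul_of ht, (hzc t (hT'T ht)).eq]
    obtain ⟨c, hc⟩ := hε.scalar (trunc T' z) (trunc_trunc _ _) hz'c
    have haza : a * z * a = a * trunc T' z * a := by
      rw [← hz]
      let F : MonoidAlgebra K G →ₗ[K] MonoidAlgebra K G :=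
        LinearMap.mulRight K a ∘ₗ LinearMap.mulLeft K a
      exact linearMap_ext_of (f := F ∘ₗ trunc T) (g := F ∘ₗ trunc T' ∘ₗ trunc T) (fun t => by
          simp only [F, LinearMap.comp_apply, LinearMap.mulRight_apply, LinearMap.mulLeft_apply,
            trunc_of]
          by_cases ht : t ∈ T
          · by_cases ht' : t ∈ T'
            · rw [if_pos ht, trunc_of, if_pos ht']
            · rw [if_pos ht, trunc_of, if_neg ht', hata t ht ht', mul_zero, zero_mul]
          · rw [if_neg ht, map_zero]) z
    refine ⟨c, hfy z c hzc ?_⟩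
    have h1 : a * z = z * a := haT' z fun t ht => hzc t (hT'T ht)
    have h2 : a * trunc T' z = trunc T' z * a := haT' _ hz'c
    rw [← hc, ← hεa, mul_assoc, mul_assoc]
    congr 1
    rw [← haa, mul_assoc, h1, ← mul_assoc, haza, mul_assoc, ← h2, ← mul_assoc]

end Completion

section Tower

variable {p : ℕ} {K : Type} [Field K] {G : Type} [Group G]

theorem subAlgebraMap_mul_of_fixed {S : Subgroup G} {y : MonoidAlgebra K G}
    (h : ∀ s ∈ S, of K G s * y = y) (z : MonoidAlgebra K S) :
    subAlgebraMap K S z * y = MonoidAlgebra.lift K K S 1 z • y :=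
  linearMap_eq_of_span (span_range_of K S)
    (f := LinearMap.mulRight K y ∘ₗ (subAlgebraMap K S).toLinearMap)
    (g := (MonoidAlgebra.lift K K S 1).toLinearMap.smulRight y) (fun s => by
      rw [LinearMap.comp_apply, AlgHom.toLinearMap_apply, subAlgebraMap_of,
        LinearMap.mulRight_apply, h s s.2]
      simp) z

theorem mul_subAlgebraMap_of_fixed {S : Subgroup G} {y : MonoidAlgebra K G}
    (h : ∀ s ∈ S, y * of K G s = y) (z : MonoidAlgebra K S) :
    y * subAlgebraMap K S z = MonoidAlgebra.lift K K S 1 z • y :=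
  linearMap_eq_of_span (span_range_of K S)
    (f := LinearMap.mulLeft K y ∘ₗ (subAlgebraMap K S).toLinearMap)
    (g := (MonoidAlgebra.lift K K S 1).toLinearMap.smulRight y) (fun s => by
      rw [LinearMap.comp_apply, AlgHom.toLinearMap_apply, subAlgebraMap_of,
        LinearMap.mulLeft_apply, h s s.2]
      simp) z

/-- The idempotent of the trivial representation of a normal subgroup. -/
theorem exists_isGood_trivial (p : ℕ) [CharZero K] (S : Subgroup G) [hS : S.Normal] [Finite S] :
    ∃ e : MonoidAlgebra K S, IsGood p e ∧ (∀ g, Commute (of K G g) (subAlgebraMap K S e)) ∧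
      (∀ s ∈ S, of K G s * subAlgebraMap K S e = subAlgebraMap K S e) ∧
      ∀ y, (∀ s ∈ S, of K G s * y = y) → subAlgebraMap K S e * y = y := by
  obtain ⟨e, h1, h2, h3, h4⟩ := exists_central_idempotent (MonoidAlgebra.lift K K S 1)
  have hfix : ∀ s : S, of K S s * e = e := fun s => by
    have h := h4 (of K S s - 1) (by simp)
    rw [mul_sub, mul_one, sub_eq_zero, h2] at h
    exact h
  have hl : ∀ s ∈ S, of K G s * subAlgebraMap K S e = subAlgebraMap K S e := fun s hs => by
    have h := congrArg (subAlgebraMap K S) (hfix ⟨s, hs⟩)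
    rwa [map_mul, subAlgebraMap_of] at h
  have hr : ∀ s ∈ S, subAlgebraMap K S e * of K G s = subAlgebraMap K S e := fun s hs => by
    have h := congrArg (subAlgebraMap K S) (hfix ⟨s, hs⟩)
    rwa [← h2, map_mul, subAlgebraMap_of] at h
  refine ⟨e, ⟨K, _, _, 1, ⟨inferInstance, inferInstance, inferInstance, ⟨⊥, ?_, ?_⟩, ?_⟩,
    h1, h2, h3, h4⟩, fun g => ?_, hl, fun y hy => ?_⟩
  · exact IsPGroup.of_bot
  · simp
  · intro V _ _ _ σ m
    exact ⟨0, by simp⟩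
  · have h5 := subAlgebraMap_mul_of_fixed (y := of K G g * subAlgebraMap K S e) (fun s hs => by
      have h6 : of K G s * of K G g = of K G g * of K G (g⁻¹ * s * g) := by
        rw [← map_mul, ← map_mul]; congr 1; group
      rw [← mul_assoc, h6, mul_assoc, hl _ (by simpa using hS.conj_mem s hs g⁻¹)]) e
    have h7 := mul_subAlgebraMap_of_fixed (y := subAlgebraMap K S e * of K G g) (fun s hs => by
      have h6 : of K G g * of K G s = of K G (g * s * g⁻¹) * of K G g := by
        rw [← map_mul, ← map_mul]; congr 1; group
      rw [mul_assoc, h6, ← mul_assoc, hr _ (hS.conj_mem s hs g)]) e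
    rw [h3, one_smul] at h5 h7
    change of K G g * _ = _ * of K G g
    rw [← h5, ← mul_assoc, h7]
  · rw [subAlgebraMap_mul_of_fixed hy, h3, one_smul]

variable [Fintype G] [CharZero K] (hp : p.Prime) (hK : ∀ a : ℕ, ∃ ζ : K, IsPrimitiveRoot ζ (p ^ a))
  (hG : IsPSolvable p G) {r : ℕ} {N : ℕ → Subgroup G} (hr : N r = ⊤)
  (hnorm : ∀ i, (N i).Normal) (hlt : ∀ i, i < r → N i < N (i + 1))
  (hchief : ∀ i, i < r → ∀ M : Subgroup G, M.Normal → N i ≤ M → M ≤ N (i + 1) →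
    M = N i ∨ M = N (i + 1))

include hp hK hG hr hnorm hlt hchief

/-- A good idempotent at any level of a chief series can be completed. -/
theorem IsGood.exists_isCompletion (k : ℕ) : ∀ (j : ℕ) (T : Subgroup G), j + k = r →
    ∀ e : MonoidAlgebra K (N j ⊓ T : Subgroup G), IsGood p e →
      ∃ ε, IsCompletion T (subAlgebraMap K (N j ⊓ T) e) ε := by
  induction k with
  | zero =>
    rintro j T rfl e he
    have hT : N j ⊓ T = T := by rw [add_zero] at hr; rw [hr, top_inf_eq]
    refine ⟨subAlgebraMap K (N j ⊓ T) e, ⟨fun h => he.ne_zero (subAlgebraMap_injective _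
      (by rw [map_zero]; exact h)), by rw [← map_mul, he.idem], fun t ht => ?_,
      fun u _ h => h, fun z hz hc => ?_⟩⟩
    · have h := congrArg (subAlgebraMap K _) (he.comm (of K _ ⟨t, hT.ge ht⟩))
      rw [map_mul, map_mul, subAlgebraMap_of] at h
      exact h.symm
    · obtain ⟨z₀, h0⟩ := exists_subAlgebraMap_eq_trunc (N j ⊓ T) z
      have h1 : trunc (N j ⊓ T) z = z := by rw [hT, hz]
      obtain ⟨c, h2⟩ := he.exists_smul (z := z₀) fun x => subAlgebraMap_injective _ (by
        rw [map_mul, map_mul, h0, h1]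
        exact (commute_subAlgebraMap (S := N j ⊓ T) (fun t ht => hc t ht.2) x).symm)
      exact ⟨c, by rw [← h1, ← h0, ← map_mul, h2, map_smul]⟩
  | succ k ih =>
    intro j T hjk
    have hj : j < r := by omega
    set M := N j ⊓ T with hM
    intro e he
    set a := subAlgebraMap K M e with ha
    have hn : ∀ t ∈ T, ∀ m, m ∈ M ↔ t * m * t⁻¹ ∈ M := fun t ht m => by
      have h1 : ∀ s ∈ T, ∀ m ∈ M, s * m * s⁻¹ ∈ M := fun s hs m hm =>
        Subgroup.mem_inf.2 ⟨(hnorm j).conj_mem m hm.1 s,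
          T.mul_mem (T.mul_mem hs hm.2) (T.inv_mem hs)⟩
      exact ⟨h1 t ht m, fun h => by simpa [mul_assoc] using h1 t⁻¹ (inv_mem ht) _ h⟩
    let T' : Subgroup G :=
      { carrier := {t | t ∈ T ∧ Commute (of K G t) a}
        one_mem' := ⟨one_mem _, by rw [map_one]; exact Commute.one_left a⟩
        mul_mem' := fun {x y} hx hy => ⟨mul_mem hx.1 hy.1, by
          rw [map_mul]; exact hx.2.mul_left hy.2⟩
        inv_mem' := fun {x} hx => ⟨inv_mem hx.1, by
          have h := hx.2.eq
          change of K G x⁻¹ * a = a * of K G x⁻¹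
          rw [← mul_one (of K G x⁻¹ * a), ← of_mul_of_inv x, ← mul_assoc, mul_assoc _ a, ← h,
            ← mul_assoc, of_inv_mul_of, one_mul]⟩ }
    have hT' : ∀ t, t ∈ T' ↔ t ∈ T ∧ Commute (of K G t) a := fun _ => Iff.rfl
    set L := N (j + 1) ⊓ T' with hL
    have hMT : M ≤ T := inf_le_right
    have hML : M ≤ L := fun m hm => ⟨(hlt j hj).le hm.1, hm.2, by
      have h := congrArg (subAlgebraMap K M) (he.comm (of K M ⟨m, hm⟩))
      rw [map_mul, map_mul, subAlgebraMap_of] at h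
      exact h.symm⟩
    let i : M →* L := Subgroup.inclusion hML
    have hiinj : Function.Injective i := Subgroup.inclusion_injective hML
    have hir : ∀ l : L, l ∈ i.range ↔ (l : G) ∈ M := fun l => by
      rw [Subgroup.inclusion_range, Subgroup.mem_subgroupOf]
    have hin : i.range.Normal := ⟨fun m hm g => by
      rw [hir] at hm ⊢
      exact (hn g g.2.2.1 m).1 hm⟩
    have hia : subAlgebraMap K L (groupAlgebraMap K i e) = a := subAlgebraMap_inclusion hML e
    have hcomm : ∀ x, groupAlgebraMap K i e * x = x * groupAlgebraMap K i e := fun x =>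
      subAlgebraMap_injective L (by
        rw [map_mul, map_mul, hia]
        exact (commute_subAlgebraMap (S := L) (fun l hl => hl.2.2) x).symm)
    have := hnorm j
    have := hnorm (j + 1)
    obtain ⟨m, hm, hpow⟩ := exists_pow_mem_of_chief hG (hlt j hj) (hchief j hj)
    obtain ⟨ε₁, hε₁, hε₁e⟩ : ∃ ε₁ : MonoidAlgebra K L, IsGood p ε₁ ∧
        ε₁ * groupAlgebraMap K i e = ε₁ := by
      rcases isPGroup_or_coprime_index hp i.range hm (fun g => by
        rw [hir]
        exact ⟨hpow g g.2.1, pow_mem g.2.2.1 m⟩) with hi | hi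
      · have hidem : groupAlgebraMap K i e * groupAlgebraMap K i e = groupAlgebraMap K i e := by
          rw [← map_mul, he.idem]
        exact he.exists_of_isPGroup hp hK i hi hidem hcomm
          (fun h => he.ne_zero (groupAlgebraMap_injective K hiinj (by rw [map_zero]; exact h)))
          hidem
      · exact he.exists_of_coprime hp i hiinj hi fun g => (hcomm _).symm
    obtain ⟨ε, hε⟩ := ih (j + 1) T' (by omega) ε₁ hε₁
    have hbridge : subAlgebraMap K L ε₁ * a = subAlgebraMap K L ε₁ := by
      rw [← hia, ← map_mul, hε₁e]
    exact IsCompletion.exists_of_stabilizer he hMT hn hT' (ε := ε)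
      ⟨hε.ne_zero, hε.idem, hε.comm, fun u hu h => hε.absorb u hu (by
        rw [← hbridge, mul_assoc]; exact congrArg _ h), hε.scalar⟩

/-- Every chief factor of `p`-power order carries a central idempotent with scalar centre. -/
theorem exists_idempotent_of_isPGroup {i : ℕ} (hi : i < r)
    (hcard : ∃ k : ℕ, Nat.card ((N (i + 1) : Subgroup G) ⧸ (N i).subgroupOf (N (i + 1))) = p ^ k) :
    ∃ ε : MonoidAlgebra K G, ε ≠ 0 ∧ ε * ε = ε ∧ (∀ g, Commute (of K G g) ε) ∧
      (∀ z, (∀ g, Commute (of K G g) z) → ∃ c : K, ε * z = c • ε) ∧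
      (∀ g ∈ N i, ε * of K G g = ε) ∧
      ε * ∑ g : G, (if g ∈ N (i + 1) then of K G g else 0) = 0 := by
  set L := N (i + 1) ⊓ ⊤ with hL
  have hLN : L = N (i + 1) := inf_top_eq _
  have hMi := hnorm i
  have hLn : L.Normal := hLN ▸ hnorm (i + 1)
  have hML : N i ≤ L := hLN ▸ (hlt i hi).le
  obtain ⟨e₀, he₀, h0c, h0l, h0f⟩ := exists_isGood_trivial (K := K) p (N i)
  obtain ⟨e₁, he₁, h1c, h1l, h1f⟩ := exists_isGood_trivial (K := K) p L
  set a₀ := subAlgebraMap K (N i) e₀ with ha₀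
  set a₁ := subAlgebraMap K L e₁ with ha₁
  let ι : N i →* L := Subgroup.inclusion hML
  have hιa : subAlgebraMap K L (groupAlgebraMap K ι e₀) = a₀ := subAlgebraMap_inclusion hML e₀
  have hsub := subAlgebraMap_injective (K := K) L
  have h00 : a₀ * a₀ = a₀ := h0f _ h0l
  have h11 : a₁ * a₁ = a₁ := h1f _ h1l
  have h01 : a₀ * a₁ = a₁ := h0f _ fun s hs => h1l s (hML hs)
  have h10 : a₁ * a₀ = a₁ := by
    rw [commute_subAlgebraMap (fun g _ => h0c g) e₁, h01]
  have hne : a₀ - a₁ ≠ 0 := fun h => by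
    obtain ⟨g, hg, hg'⟩ := SetLike.exists_of_lt (hlt i hi)
    rw [sub_eq_zero] at h
    have h2 : of K G g * a₀ = a₀ := by rw [h]; exact h1l g (hLN ▸ hg)
    have h3 : trunc (N i) (of K G g * a₀) = 0 :=
      linearMap_eq_of_span (span_range_of K (N i))
        (f := trunc (N i) ∘ₗ LinearMap.mulLeft K (of K G g) ∘ₗ
          (subAlgebraMap K (N i)).toLinearMap) (g := 0) (fun m => by
          simp only [LinearMap.comp_apply, AlgHom.toLinearMap_apply, subAlgebraMap_of,
            LinearMap.mulLeft_apply, ← map_mul]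
          rw [trunc_of, if_neg fun h => hg' ((Subgroup.mul_mem_cancel_right _ m.2).1 h),
            LinearMap.zero_apply]) e₀
    rw [h2, trunc_subAlgebraMap le_rfl] at h3
    exact he₀.ne_zero (subAlgebraMap_injective _ (by rw [map_zero]; exact h3))
  have hιr : ι.range = (N i).subgroupOf L := Subgroup.inclusion_range hML
  have hιn : ι.range.Normal := by rw [hιr]; infer_instance
  have hιp : IsPGroup p (L ⧸ ι.range) := by
    have := Fact.mk hp
    refine IsPGroup.iff_card.2 ?_
    change ∃ k, ι.range.index = p ^ k
    rw [hιr]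
    change ∃ k, (N i).relIndex L = p ^ k
    rw [hLN]
    exact hcard
  obtain ⟨ε₁, hε₁, hε₁f⟩ := he₀.exists_of_isPGroup hp hK ι hιp (f := groupAlgebraMap K ι e₀ - e₁)
    (hsub (by
      simp only [map_mul, map_sub, hιa, ← ha₁, mul_sub, sub_mul, h00, h11, h01, h10]
      abel))
    (fun x => hsub (by
      rw [map_mul, map_mul, map_sub, hιa]
      exact (commute_subAlgebraMap (fun l _ => (h0c l).sub_right (h1c l)) x).symm))
    (fun h => hne (by rw [← hιa, ha₁, ← map_sub, h, map_zero]))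
    (hsub (by simp only [map_mul, map_sub, hιa, ← ha₁, sub_mul, h00, h10]))
  obtain ⟨ε, hε⟩ := IsGood.exists_isCompletion hp hK hG hr hnorm hlt hchief (r - (i + 1)) (i + 1) ⊤
    (by omega) ε₁ hε₁
  set b := subAlgebraMap K L ε₁ with hb
  have hbf : b * (a₀ - a₁) = b := by
    rw [← hιa, ha₁, ← map_sub, hb, ← map_mul, hε₁f]
  have hεa₀ : ε * a₀ = ε := hε.absorb _ (fun g _ => h0c g) (by
    rw [← hbf, mul_assoc, sub_mul, h00, h10])
  have hεa₁ : ε * a₁ = 0 := by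
    have h := hε.absorb (1 - a₁) (fun g _ => (Commute.one_right _).sub_right (h1c g)) (by
      have h2 : (a₀ - a₁) * (1 - a₁) = a₀ - a₁ := by
        rw [mul_sub, mul_one, sub_mul, h01, h11, sub_self, sub_zero]
      rw [← hbf, mul_assoc, h2])
    rwa [mul_sub, mul_one, sub_eq_self] at h
  refine ⟨ε, hε.ne_zero, hε.idem, fun g => hε.comm g trivial, fun z hz =>
    hε.scalar z (trunc_top z) fun g _ => hz g, fun g hg => ?_, ?_⟩
  · rw [← hεa₀, mul_assoc, ← (h0c g).eq, h0l g hg]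
  · rw [← h1f (∑ g : G, (if g ∈ N (i + 1) then of K G g else 0)) fun s hs => ?_, ← mul_assoc,
      hεa₁, zero_mul]
    rw [Finset.mul_sum, ← Equiv.sum_comp (Equiv.mulLeft s) fun g =>
      if g ∈ N (i + 1) then of K G g else 0]
    rw [hLN] at hs
    refine Finset.sum_congr rfl fun g _ => ?_
    simp only [Equiv.coe_mulLeft, Subgroup.mul_mem_cancel_left _ hs]
    split_ifs
    · rw [map_mul]
    · rw [mul_zero]

end Tower

section Characters

variable {G : Type} [Group G]

theorem isIrreducible_ofModule' {k V : Type} [Field k] [AddCommGroup V] [Module k V]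
    [Module (MonoidAlgebra k G) V] [IsScalarTower k (MonoidAlgebra k G) V]
    [IsSimpleModule (MonoidAlgebra k G) V] :
    (Representation.ofModule' (k := k) (G := G) V).IsIrreducible := by
  rw [Representation.irreducible_iff_isSimpleModule_asModule]
  have h (a : MonoidAlgebra k G) (v : V) :
      (Representation.ofModule' (k := k) (G := G) V).asAlgebraHom a v = a • v := by
    change MonoidAlgebra.lift k _ G ((MonoidAlgebra.lift k _ G).symm (Algebra.lsmul k k V)) a v = _
    rw [Equiv.apply_symm_apply, Algebra.lsmul_coe]
  let f : (Representation.ofModule' (k := k) (G := G) V).asModule ≃ₗ[MonoidAlgebra k G] V :=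
    { (Representation.ofModule' (k := k) (G := G) V).asModuleEquiv with
      map_smul' := fun a v => by
        change Representation.asModuleEquiv _ (a • v) = a • Representation.asModuleEquiv _ v
        rw [Representation.asModuleEquiv_map_smul, h] }
  exact IsSimpleModule.congr f

variable [Fintype G]

theorem simple_of_isIrreducible {V : Type} [AddCommGroup V] [Module ℂ V] [Module.Finite ℂ V]
    (ρ : Representation ℂ G V) [ρ.IsIrreducible] :
    CategoryTheory.Simple (FDRep.of ρ) := by
  have := invertibleOfNonzero (NeZero.ne (Nat.card G : ℂ))
  rw [FDRep.simple_iff_char_is_norm_one]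
  have h := Representation.char_orthonormal ρ ρ
  rw [if_pos ⟨Representation.Equiv.refl ρ⟩, inv_mul_eq_one₀ (NeZero.ne _)] at h
  exact h.symm

theorem finite_isIrreducibleCharacter : {χ : G → ℂ | IsIrreducibleCharacter G χ}.Finite := by
  have := invertibleOfNonzero (NeZero.ne (Nat.card G : ℂ))
  let B : LinearMap.BilinForm ℂ (G → ℂ) := LinearMap.mk₂ ℂ (fun f h => ∑ g, f g * h g⁻¹)
    (fun f f' h => by simp [add_mul, Finset.sum_add_distrib])
    (fun c f h => by simp [mul_assoc, Finset.mul_sum])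
    (fun f h h' => by simp [mul_add, Finset.sum_add_distrib])
    (fun c f h => by simp [mul_left_comm, Finset.mul_sum])
  have hB (f h : G → ℂ) : B f h = ∑ g, f g * h g⁻¹ := rfl
  have hli : LinearIndependent ℂ
      (Subtype.val : {χ : G → ℂ | IsIrreducibleCharacter G χ} → G → ℂ) := by
    refine LinearMap.BilinForm.linearIndependent_of_iIsOrtho (B := B) ?_ ?_
    · rintro ⟨_, V, hV, rfl⟩ ⟨_, W, hW, rfl⟩ hne
      change B _ _ = 0
      rw [hB]
      have h := FDRep.char_orthonormal V W
      rw [if_neg fun ⟨f⟩ => hne (Subtype.ext (FDRep.char_iso f)), mul_eq_zero] at h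
      exact h.resolve_left (inv_ne_zero (NeZero.ne _))
    · rintro ⟨_, V, hV, rfl⟩ h0
      change B _ _ = 0 at h0
      rw [hB] at h0
      have h := FDRep.char_orthonormal V V
      rw [if_pos ⟨CategoryTheory.Iso.refl V⟩, h0, mul_zero] at h
      exact zero_ne_one h
  exact hli.setFinite

/-- A central idempotent over `K` with scalar centre carries an irreducible `K`-valued character. -/
theorem exists_simple_of_idempotent (K : Subfield ℂ) {ε : MonoidAlgebra K G} (h0 : ε ≠ 0)
    (hidem : ε * ε = ε) (hcomm : ∀ g, Commute (of K G g) ε)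
    (hscalar : ∀ z, (∀ g, Commute (of K G g) z) → ∃ c : K, ε * z = c • ε) :
    ∃ V : FDRep ℂ G, CategoryTheory.Simple V ∧ (∀ g, V.character g ∈ K) ∧ V.character 1 ≠ 0 ∧
      (∀ g, ε * of K G g = ε → V.character g = V.character 1) ∧
      ∀ S : Subgroup G, ε * ∑ g : G, (if g ∈ S then of K G g else 0) = 0 →
        ∑ g : G, (if g ∈ S then V.character g else 0) = 0 := by
  let φ : MonoidAlgebra K G →+* MonoidAlgebra ℂ G := MonoidAlgebra.mapRingHom G (algebraMap K ℂ)
  have hφinj : Function.Injective φ := fun x y h => by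
    ext g
    have h1 := congrArg (fun a : MonoidAlgebra ℂ G => a.coeff g) h
    simpa [φ] using h1
  have hφof (g : G) : φ (of K G g) = of ℂ G g := by simp [φ, of]
  have hφsmul (c : K) (x : MonoidAlgebra K G) : φ (c • x) = (c : ℂ) • φ x := by
    ext g
    simp only [φ, MonoidAlgebra.coeff_mapRingHom, MonoidAlgebra.coeff_smul, Finsupp.smul_apply,
      smul_eq_mul, map_mul]
    rfl
  have hφcomm (a : MonoidAlgebra ℂ G) : φ ε * a = a * φ ε :=
    linearMap_eq_of_span (span_range_of ℂ G) (f := LinearMap.mulLeft ℂ (φ ε))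
      (g := LinearMap.mulRight ℂ (φ ε)) (fun g => by
        rw [LinearMap.mulLeft_apply, LinearMap.mulRight_apply, ← hφof, ← map_mul, ← map_mul,
          (hcomm g).eq]) a
  let I := Submodule.span (MonoidAlgebra ℂ G) {φ ε}
  have hI : ∀ v ∈ I, φ ε * v = v := fun v hv => by
    obtain ⟨a, rfl⟩ := Submodule.mem_span_singleton.1 hv
    rw [smul_eq_mul, hφcomm, mul_assoc, ← map_mul, hidem]
  have hIne : I ≠ ⊥ := fun h => h0 (hφinj (by
    rw [map_zero]; exact Submodule.span_singleton_eq_bot.1 h))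
  have : Nontrivial I := Submodule.nontrivial_iff_ne_bot.2 hIne
  obtain ⟨W, _, _, _, _, _, _, hact⟩ : ∃ (W : Type) (_ : AddCommGroup W) (_ : Module ℂ W)
      (_ : Module (MonoidAlgebra ℂ G) W) (_ : IsScalarTower ℂ (MonoidAlgebra ℂ G) W)
      (_ : IsSimpleModule (MonoidAlgebra ℂ G) W) (_ : Module.Finite ℂ W),
      ∀ w : W, φ ε • w = w := by
    obtain ⟨S, hS⟩ := IsSemisimpleModule.exists_simple_submodule (MonoidAlgebra ℂ G) I
    exact ⟨S, inferInstance, inferInstance, inferInstance, inferInstance, hS,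
      Module.Finite.of_injective ((I.subtype.comp S.subtype).restrictScalars ℂ)
        (Subtype.val_injective.comp Subtype.val_injective),
      fun v => Subtype.ext (Subtype.ext (hI _ v.1.2))⟩
  let ρ : Representation ℂ G W := Representation.ofModule' W
  have hρ : ρ.IsIrreducible := isIrreducible_ofModule'
  have hnt : Nontrivial W := IsSimpleModule.nontrivial (MonoidAlgebra ℂ G) W
  let T : MonoidAlgebra ℂ G →ₗ[ℂ] ℂ := LinearMap.trace ℂ W ∘ₗ (Algebra.lsmul ℂ ℂ W : MonoidAlgebra ℂ G →ₐ[ℂ] _).toLinearMap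
  have hT (g : G) : T (of ℂ G g) = (FDRep.of ρ).character g := rfl
  have hTε (a : MonoidAlgebra ℂ G) : T (φ ε * a) = T a := by
    refine congrArg (LinearMap.trace ℂ W) (LinearMap.ext fun v => ?_)
    change (φ ε * a) • v = a • v
    rw [mul_smul, hact]
  refine ⟨FDRep.of ρ, simple_of_isIrreducible ρ, fun g => ?_, ?_, fun g hg => ?_, fun S hS => ?_⟩
  · obtain ⟨c, hc⟩ := hscalar (∑ x : G, of K G (x * g * x⁻¹)) fun y => by
      change _ * _ = _ * _
      rw [Finset.mul_sum, Finset.sum_mul, ← Equiv.sum_comp (Equiv.mulLeft y) fun x =>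
        of K G (x * g * x⁻¹) * of K G y]
      refine Finset.sum_congr rfl fun x _ => ?_
      rw [← map_mul, ← map_mul, Equiv.coe_mulLeft]
      congr 1
      group
    have h1 := hTε (φ (∑ x : G, of K G (x * g * x⁻¹)))
    rw [← map_mul, hc, hφsmul, map_smul, ← mul_one (φ ε), hTε, map_sum, map_sum] at h1
    simp only [hφof, hT, FDRep.char_conj] at h1
    rw [← map_one (of ℂ G), hT, FDRep.char_one] at h1
    simp only [Finset.sum_const, nsmul_eq_mul, smul_eq_mul, Finset.card_univ] at h1
    rw [← mul_div_cancel_left₀ ((FDRep.of ρ).character g)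
      (Nat.cast_ne_zero.2 (Fintype.card_ne_zero (α := G))), ← h1]
    exact div_mem (mul_mem c.2 (natCast_mem _ _)) (natCast_mem _ _)
  · rw [FDRep.char_one]
    exact Nat.cast_ne_zero.2 (Module.finrank_pos (R := ℂ) (M := W)).ne'
  · rw [← hT, ← hT, ← hTε, ← hφof, ← map_mul, hg, map_one, ← mul_one (φ ε), hTε]
  · have h1 := hTε (φ (∑ g : G, if g ∈ S then of K G g else 0))
    rw [← map_mul, hS, map_zero, map_zero, map_sum, map_sum] at h1
    refine Eq.trans ?_ h1.symm
    refine Finset.sum_congr rfl fun g _ => ?_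
    split_ifs
    · rw [hφof, hT]
    · rw [map_zero, map_zero]

end Characters

theorem exists_isPrimitiveRoot_Qfield {p : ℕ} (hp : p.Prime) (a : ℕ) :
    ∃ ζ : Qfield p, IsPrimitiveRoot ζ (p ^ a) := by
  have h := Complex.isPrimitiveRoot_exp (p ^ (a + 1)) (pow_ne_zero _ hp.ne_zero)
  have h1 : IsPrimitiveRoot (⟨_, Subfield.subset_closure ⟨a + 1, a.succ_pos, h.pow_eq_one⟩⟩ :
      Qfield p) (p ^ (a + 1)) :=
    IsPrimitiveRoot.of_map_of_injective (f := (Qfield p).subtype) h Subtype.val_injective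
  exact ⟨_, h1.pow (pow_pos hp.pos _) (pow_succ' p a)⟩

end QpChars

/-- Let `p` be a prime and `G` a finite `p`-solvable group.  For any chief series
`⊥ = N 0 < N 1 < ⋯ < N r = ⊤` of `G` (each term normal in `G`, with no normal
subgroup of `G` strictly between consecutive terms), the number of indices `i` for
which the chief factor `N (i+1) / N i` is a `p`-group is at most the number of
nonprincipal `Q_p`-valued irreducible characters of `G`. -/
theorem card_p_chiefFactors_le_nonprincipal_Qp_chars (p : ℕ) (hp : p.Prime)
    (G : Type) [Group G] [Fintype G] (hG : IsPSolvable p G)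
    (r : ℕ) (N : ℕ → Subgroup G)
    (h0 : N 0 = ⊥) (hr : N r = ⊤)
    (hnorm : ∀ i, (N i).Normal)
    (hlt : ∀ i, i < r → N i < N (i + 1))
    (hchief : ∀ i, i < r → ∀ M : Subgroup G, M.Normal → N i ≤ M → M ≤ N (i + 1) →
      M = N i ∨ M = N (i + 1)) :
    {i : ℕ | i < r ∧ ∃ k : ℕ,
        Nat.card ((N (i + 1) : Subgroup G) ⧸ (N i).subgroupOf (N (i + 1))) = p ^ k}.ncard ≤
      {χ : G → ℂ | IsIrreducibleCharacter G χ ∧ (∀ g, χ g ∈ Qfield p) ∧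
        χ ≠ fun _ => 1}.ncard := by
  have hsum (S : Subgroup G) {c : ℂ} (hc : c ≠ 0) {χ : G → ℂ} (hχ : ∀ g ∈ S, χ g = c) :
      ∑ g : G, (if g ∈ S then χ g else 0) ≠ 0 := by
    rw [← Finset.sum_filter, Finset.sum_congr rfl fun g hg => hχ g (Finset.mem_filter.1 hg).2,
      Finset.sum_const, nsmul_eq_mul]
    exact mul_ne_zero (Nat.cast_ne_zero.2 (Finset.card_ne_zero.2
      ⟨1, Finset.mem_filter.2 ⟨Finset.mem_univ _, one_mem S⟩⟩)) hc
  have hex (i : ℕ) : ∃ χ : G → ℂ, (i < r ∧ ∃ k : ℕ,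
      Nat.card ((N (i + 1) : Subgroup G) ⧸ (N i).subgroupOf (N (i + 1))) = p ^ k) →
      (IsIrreducibleCharacter G χ ∧ (∀ g, χ g ∈ Qfield p)) ∧ χ 1 ≠ 0 ∧
        (∀ g ∈ N i, χ g = χ 1) ∧ ∑ g : G, (if g ∈ N (i + 1) then χ g else 0) = 0 := by
    by_cases hi : i < r ∧ ∃ k : ℕ,
      Nat.card ((N (i + 1) : Subgroup G) ⧸ (N i).subgroupOf (N (i + 1))) = p ^ k
    · obtain ⟨ε, e0, e1, e2, e3, e4, e5⟩ := QpChars.exists_idempotent_of_isPGroup hp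
        (QpChars.exists_isPrimitiveRoot_Qfield hp) hG hr hnorm hlt hchief hi.1 hi.2
      obtain ⟨V, hV, v1, v2, v3, v4⟩ :=
        QpChars.exists_simple_of_idempotent (Qfield p) e0 e1 e2 e3
      exact ⟨V.character, fun _ => ⟨⟨⟨V, hV, rfl⟩, v1⟩, v2, fun g hg => v3 g (e4 g hg),
        v4 _ e5⟩⟩
    · exact ⟨0, fun h => absurd h hi⟩
  choose χ hχ using hex
  have hmono : ∀ i j, i ≤ j → j ≤ r → N i ≤ N j := fun i j hij => by
    induction j, hij using Nat.le_induction with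
    | base => exact fun _ => le_rfl
    | succ j _ ih => exact fun hj => (ih (by omega)).trans (hlt j hj).le
  refine Set.ncard_le_ncard_of_injOn χ (fun i hi => ?_) (fun i hi j hj hij => ?_)
    (QpChars.finite_isIrreducibleCharacter.subset fun _ h => h.1)
  · obtain ⟨h1, -, -, h2⟩ := hχ i hi
    exact ⟨h1.1, h1.2, fun h => hsum _ one_ne_zero (fun g _ => congrFun h g) h2⟩
  · have key : ∀ i j, i < j → (i < r ∧ ∃ k : ℕ,
        Nat.card ((N (i + 1) : Subgroup G) ⧸ (N i).subgroupOf (N (i + 1))) = p ^ k) →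
        (j < r ∧ ∃ k : ℕ,
        Nat.card ((N (j + 1) : Subgroup G) ⧸ (N j).subgroupOf (N (j + 1))) = p ^ k) →
        χ i ≠ χ j := fun i j hlt hi hj h => by
      obtain ⟨-, -, -, h2⟩ := hχ i hi
      obtain ⟨-, h3, h4, -⟩ := hχ j hj
      rw [h] at h2
      exact hsum _ h3 (fun g hg => h4 g (hmono _ _ hlt hj.1.le hg)) h2
    rcases lt_trichotomy i j with h | h | h
    · exact absurd hij (key i j h hi hj)
    · exact h
    · exact absurd hij.symm (key j i h hj hi)
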